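/- arXiv:2311.08332 — 3 statements merged into one kernel-verified Lean document; each statement's English description precedes it below -/
import Mathlib

section
/- Let G = (V,E) be a connected trivalent finite graph and A ⊆ V a set inducing an acyclic (forest) subgraph. Then r*(δ(A)) = |A| + ω(A) − ω(V−A) + 1, where ω denotes the number of connected components of the induced subgraph. -/
/-- A finite undirected multigraph on vertex type `V` with edge type `E`:
each edge has an unordered pair of endpoints (possibly a loop). -/
structure Multigraph (V E : Type*) where
  ends : E → Sym2 V

namespace Multigraph

variable {V E : Type*} (G : Multigraph V E)

/-- `δ(A)`: the set of edges incident to at least one vertex of `A`. -/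
def inc (A : Set V) : Set E := {e | ∃ v ∈ A, v ∈ G.ends e}

/-- Number of connected components of the spanning subgraph of `G`
with edge set `B` (on the full vertex set `V`). -/
noncomputable def numComponentsEdges (B : Set E) : ℕ :=
  Nat.card (Quot (fun u v : V => ∃ e ∈ B, G.ends e = s(u, v)))

/-- Number of connected components `ω(S)` of the subgraph of `G` induced on `S`. -/
noncomputable def numComponentsSub (S : Set V) : ℕ :=
  Nat.card (Quot (fun x y : S => ∃ e, G.ends e = s(x.1, y.1)))

/-- Rank function of the cycle (graphic) matroid of `G`:
`r(B) = |V| - (number of components of (V, B))`. -/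
noncomputable def cycleRank (B : Set E) : ℕ :=
  Nat.card V - G.numComponentsEdges B

/-- Rank function `r*` of the bond (cographic) matroid of `G`:
`r*(B) = |B| + r(E - B) - r(E)`. -/
noncomputable def bondRank (B : Set E) : ℕ :=
  B.ncard + G.cycleRank Bᶜ - G.cycleRank Set.univ

/-- `G` is connected. -/
def Connected : Prop := G.numComponentsEdges Set.univ = 1

/-- `G` is 2-edge-connected: it is connected and deleting any single edge
leaves it connected. -/
def TwoEdgeConnected : Prop :=
  G.Connected ∧ ∀ e : E, G.numComponentsEdges {e}ᶜ = 1

/-- `G` is 2-vertex-connected: it is connected and deleting any single vertex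
leaves it connected. -/
def TwoVertexConnected : Prop :=
  G.Connected ∧ ∀ v : V, G.numComponentsSub {v}ᶜ = 1

/-- `G` has no loops. -/
def Loopless : Prop := ∀ e : E, ¬ (G.ends e).IsDiag

open Classical in
/-- The degree of a vertex, with loops counting twice. -/
noncomputable def degree [Fintype E] (v : V) : ℕ :=
  ∑ e : E, (if G.ends e = s(v, v) then 2 else if v ∈ G.ends e then 1 else 0)

/-- `G` is trivalent: every vertex has degree `3`. -/
def Trivalent [Fintype E] : Prop := ∀ v : V, G.degree v = 3

/-- `A ⊆ V` is the vertex set of a cycle `v₁, …, vₙ, v₁` of `G`: there are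
pairwise distinct vertices `f 0, …, f (n-1)` with range `A` and pairwise
distinct edges joining cyclically consecutive vertices. -/
def IsCycleSet (A : Set V) : Prop :=
  ∃ n : ℕ, 0 < n ∧ ∃ f : ZMod n → V, Function.Injective f ∧ Set.range f = A ∧
    ∃ e : ZMod n → E, Function.Injective e ∧ ∀ i, G.ends (e i) = s(f i, f (i + 1))

/-- The subgraph induced on `A` contains a cycle. -/
def Cyclic (A : Set V) : Prop := ∃ C ⊆ A, G.IsCycleSet C

/-- The subgraph induced on `A` is acyclic (a forest). -/
def Acyclic (A : Set V) : Prop := ¬ G.Cyclic A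

/-- `A` is a circuit of the graph curve matroid `M_G`: `A` is nonempty,
`r*(δ(A)) ≤ |A|`, and no proper nonempty subset `A'` satisfies `r*(δ(A')) ≤ |A'|`. -/
noncomputable def IsCircuitMG (A : Set V) : Prop :=
  A.Nonempty ∧ G.bondRank (G.inc A) ≤ A.ncard ∧
    ∀ A' : Set V, A' ⊂ A → A'.Nonempty → A'.ncard < G.bondRank (G.inc A')

/-- `A` is dependent in the graph curve matroid `M_G`, i.e. contains a circuit. -/
noncomputable def DepMG (A : Set V) : Prop := ∃ C ⊆ A, G.IsCircuitMG C

/-- `A` is independent in the graph curve matroid `M_G`. -/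
noncomputable def IndepMG (A : Set V) : Prop := ¬ G.DepMG A

/-- The rank function of the graph curve matroid `M_G`:
the maximal cardinality of an independent subset. -/
noncomputable def rankMG (A : Set V) : ℕ :=
  sSup {n | ∃ I ⊆ A, G.IndepMG I ∧ I.ncard = n}

/-- `B` is a basis of the graph curve matroid `M_G`:
a maximal independent set. -/
noncomputable def IsBasisMG (B : Set V) : Prop :=
  G.IndepMG B ∧ ∀ I : Set V, G.IndepMG I → B ⊆ I → I = B

end Multigraph

namespace Multigraph

/-- The edges with all endpoints in `S`. -/
def insideE {V E : Type*} (G : Multigraph V E) (S : Set V) : Set E :=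
  {e | ∀ v ∈ G.ends e, v ∈ S}

lemma compl_inc_eq {V E : Type*} (G : Multigraph V E) (A : Set V) :
    (G.inc A)ᶜ = G.insideE Aᶜ := by
  ext e
  simp only [inc, insideE, Set.mem_compl_iff, Set.mem_ofPred_eq]
  constructor
  · intro h v hv hA
    exact h ⟨v, hA, hv⟩
  · rintro h ⟨v, hA, hv⟩
    exact h v hv hA

open Classical in
lemma comp_inside {V E : Type*} [Fintype V] (G : Multigraph V E) (S : Set V) :
    G.numComponentsEdges (G.insideE S) = G.numComponentsSub S + Sᶜ.ncard := by
  unfold numComponentsEdges numComponentsSub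
  rw [← Nat.card_coe_set_eq, ← Nat.card_sum]
  have hmem : ∀ {e u v}, e ∈ G.insideE S → G.ends e = s(u, v) → u ∈ S ∧ v ∈ S := by
    intro e u v he h
    exact ⟨he u (by rw [h]; simp), he v (by rw [h]; simp)⟩
  refine Nat.card_congr
    { toFun := Quot.lift (fun v => if h : v ∈ S then Sum.inl (Quot.mk _ ⟨v, h⟩)
        else Sum.inr ⟨v, h⟩) ?_
      invFun := Sum.elim (Quot.lift (fun x => Quot.mk _ x.1) ?_) (fun x => Quot.mk _ x.1)
      left_inv := ?_
      right_inv := ?_ }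
  · rintro u v ⟨e, he, h⟩
    obtain ⟨hu, hv⟩ := hmem he h
    simp only [hu, hv, dite_true]
    exact congrArg _ (Quot.sound ⟨e, h⟩)
  · rintro ⟨x, hx⟩ ⟨y, hy⟩ ⟨e, h⟩
    refine Quot.sound ⟨e, ?_, h⟩
    intro w hw
    rw [h] at hw
    rcases Sym2.mem_iff.1 hw with rfl | rfl
    · exact hx
    · exact hy
  · rintro ⟨v⟩
    by_cases h : v ∈ S <;> simp [h]
  · rintro (⟨⟨v, h⟩⟩ | ⟨v, h⟩)
    · simp [h]
    · have h' : v ∉ S := h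
      simp [h']

/-- The edge relation. -/
def eRel {V E : Type*} (G : Multigraph V E) (B : Set E) (u v : V) : Prop :=
  ∃ e ∈ B, G.ends e = s(u, v)

lemma comp_insert_same {V E : Type*} (G : Multigraph V E) (B : Set E) (e : E)
    (u v : V) (he : G.ends e = s(u, v))
    (huv : Quot.mk (G.eRel B) u = Quot.mk (G.eRel B) v) :
    G.numComponentsEdges B = G.numComponentsEdges (insert e B) := by
  change Nat.card (Quot (G.eRel B)) = Nat.card (Quot (G.eRel (insert e B)))
  refine Nat.card_congr
    { toFun := Quot.lift (fun x => Quot.mk _ x) ?_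
      invFun := Quot.lift (fun x => Quot.mk _ x) ?_
      left_inv := ?_
      right_inv := ?_ }
  · rintro x y ⟨f, hf, h⟩
    exact Quot.sound ⟨f, Or.inr hf, h⟩
  · rintro x y ⟨f, hf | hf, h⟩
    · subst hf
      rw [he] at h
      rcases Sym2.eq_iff.1 h with ⟨rfl, rfl⟩ | ⟨rfl, rfl⟩
      · exact huv
      · exact huv.symm
    · exact Quot.sound ⟨f, hf, h⟩
  · rintro ⟨x⟩
    rfl
  · rintro ⟨x⟩
    rfl

open Classical in
lemma comp_insert_diff {V E : Type*} [Fintype V] (G : Multigraph V E) (B : Set E) (e : E)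
    (u v : V) (he : G.ends e = s(u, v))
    (huv : Quot.mk (G.eRel B) u ≠ Quot.mk (G.eRel B) v) :
    G.numComponentsEdges B = G.numComponentsEdges (insert e B) + 1 := by
  change Nat.card (Quot (G.eRel B)) = Nat.card (Quot (G.eRel (insert e B))) + 1
  have hfin : Finite (Quot (G.eRel B)) := inferInstance
  have key : Nat.card (Quot (G.eRel (insert e B)))
      = Nat.card {q : Quot (G.eRel B) // q ≠ Quot.mk _ v} := by
    refine Nat.card_congr
      { toFun := Quot.lift (fun x => if h : Quot.mk (G.eRel B) x = Quot.mk _ v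
          then ⟨Quot.mk _ u, huv⟩ else ⟨Quot.mk _ x, h⟩) ?_
        invFun := fun q => Quot.lift (fun x => Quot.mk (G.eRel (insert e B)) x) ?_ q.1
        left_inv := ?_
        right_inv := ?_ }
    · rintro x y ⟨f, hf | hf, h⟩
      · subst hf
        rw [he] at h
        rcases Sym2.eq_iff.1 h with ⟨rfl, rfl⟩ | ⟨rfl, rfl⟩
        · simp [huv]
        · simp [huv]
      · have hxy : Quot.mk (G.eRel B) x = Quot.mk _ y := Quot.sound ⟨f, hf, h⟩
        simp [hxy]
    · rintro x y ⟨f, hf, h⟩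
      exact Quot.sound ⟨f, Or.inr hf, h⟩
    · rintro ⟨x⟩
      have lift_eq : ∀ {x y : V}, Quot.mk (G.eRel B) x = Quot.mk _ y →
          Quot.mk (G.eRel (insert e B)) x = Quot.mk _ y := by
        intro x y hxy
        have := congrArg (Quot.lift (fun x => Quot.mk (G.eRel (insert e B)) x)
          (by rintro x y ⟨f, hf, h⟩; exact Quot.sound ⟨f, Or.inr hf, h⟩)) hxy
        exact this
      by_cases h : Quot.mk (G.eRel B) x = Quot.mk _ v
      · simp only [h, dite_true]
        exact (Quot.sound ⟨e, Or.inl rfl, he⟩ : Quot.mk (G.eRel (insert e B)) u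
          = Quot.mk _ v).trans (lift_eq h).symm
      · simp only [h, dite_false]
    · rintro ⟨⟨x⟩, h⟩
      have h' : ¬ Quot.mk (G.eRel B) x = Quot.mk _ v := h
      simp [h']
  rw [key]
  have := Fintype.ofFinite (Quot (G.eRel B))
  have hpos : 0 < Fintype.card (Quot (G.eRel B)) := Fintype.card_pos_iff.2 ⟨Quot.mk _ v⟩
  rw [Nat.card_eq_fintype_card, Nat.card_eq_fintype_card, Fintype.card_subtype_compl,
    Fintype.card_subtype_eq]
  omega

lemma comp_le_union {V E : Type*} [Fintype V] [Fintype E] (G : Multigraph V E) (C D : Set E) :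
    G.numComponentsEdges C ≤ G.numComponentsEdges (D ∪ C) + D.ncard := by
  induction D, D.toFinite using Set.Finite.induction_on with
  | empty => simp
  | @insert e D he hD ih =>
    rw [Set.ncard_insert_of_notMem he hD, Set.insert_union]
    obtain ⟨u, v, h⟩ : ∃ u v, G.ends e = s(u, v) := by
      induction h : G.ends e using Sym2.ind with
      | _ u v => exact ⟨u, v, rfl⟩
    by_cases huv : Quot.mk (G.eRel (D ∪ C)) u = Quot.mk (G.eRel (D ∪ C)) v
    · have := G.comp_insert_same (D ∪ C) e u v h huv
      omega
    · have := G.comp_insert_diff (D ∪ C) e u v h huv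
      omega

lemma comp_empty {V E : Type*} (G : Multigraph V E) :
    G.numComponentsEdges ∅ = Nat.card V := by
  refine Nat.card_congr
    { toFun := Quot.lift id ?_
      invFun := Quot.mk _
      left_inv := ?_
      right_inv := ?_ }
  · rintro x y ⟨f, hf, h⟩
    exact hf.elim
  · rintro ⟨x⟩
    rfl
  · intro x
    rfl

/-- `B` contains the edges of a cycle. -/
def EdgeCyc {V E : Type*} (G : Multigraph V E) (B : Set E) : Prop :=
  ∃ n : ℕ, 0 < n ∧ ∃ f : ZMod n → V, Function.Injective f ∧
    ∃ e : ZMod n → E, Function.Injective e ∧ (∀ i, e i ∈ B) ∧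
      ∀ i, G.ends (e i) = s(f i, f (i + 1))

/-- The underlying simple graph. -/
def underlying {V E : Type*} (G : Multigraph V E) (B : Set E) : SimpleGraph V where
  Adj u v := u ≠ v ∧ G.eRel B u v
  symm := ⟨by
    rintro u v ⟨h, e, he, h'⟩
    exact ⟨h.symm, e, he, by rw [h', Sym2.eq_swap]⟩⟩
  loopless := ⟨fun u h => h.1 rfl⟩

lemma reach_of_mk {V E : Type*} (G : Multigraph V E) (B : Set E) (u v : V)
    (h : Quot.mk (G.eRel B) u = Quot.mk (G.eRel B) v) : (G.underlying B).Reachable u v := by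
  have h' := Quot.eqvGen_exact h
  induction h' with
  | rel x y hxy =>
    by_cases e : x = y
    · subst e; rfl
    · exact SimpleGraph.Adj.reachable ⟨e, hxy⟩
  | refl x => rfl
  | symm x y _ ih => exact (ih (Quot.eqvGen_sound ‹_›)).symm
  | trans x y z _ _ ih1 ih2 =>
    exact (ih1 (Quot.eqvGen_sound ‹_›)).trans (ih2 (Quot.eqvGen_sound ‹_›))

open Classical in
lemma cyc_of_conn {V E : Type*} (G : Multigraph V E) (B : Set E) (e : E) (heB : e ∉ B)
    (u v : V) (he : G.ends e = s(u, v))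
    (huv : Quot.mk (G.eRel B) u = Quot.mk (G.eRel B) v) : G.EdgeCyc (insert e B) := by
  obtain ⟨p, hp⟩ := (G.reach_of_mk B u v huv).exists_isPath
  have hinj := hp.getVert_injOn
  have hedge : ∀ i, ∃ f, i < p.length → f ∈ B ∧ G.ends f = s(p.getVert i, p.getVert (i+1)) := by
    intro i
    by_cases hi : i < p.length
    · obtain ⟨_, f, hf, h⟩ := p.adj_getVert_succ hi
      exact ⟨f, fun _ => ⟨hf, h⟩⟩
    · exact ⟨e, fun h => absurd h hi⟩
  choose g hg using hedge
  have hge : ∀ i, i < p.length → g i ≠ e := fun i hi h => heB (h ▸ (hg i hi).1)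
  refine ⟨p.length + 1, by omega, fun i : Fin (p.length + 1) => p.getVert i.val, ?_,
    fun i : Fin (p.length + 1) => if i.val < p.length then g i.val else e, ?_, ?_, ?_⟩
  · intro i j hij
    exact Fin.ext (hinj (by have := i.2; simp; omega) (by have := j.2; simp; omega) hij)
  · intro (i : Fin _) (j : Fin _) hij
    have hi := i.2
    have hj := j.2
    dsimp only at hij
    apply Fin.ext
    split_ifs at hij with h1 h2 h2
    · have e1 := (hg _ h1).2
      have e2 := (hg _ h2).2
      rw [hij, e2] at e1
      have inj : ∀ a b, a ≤ p.length → b ≤ p.length → p.getVert a = p.getVert b → a = b :=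
        fun a b ha hb h => hinj ha hb h
      rcases Sym2.eq_iff.1 e1 with ⟨h, _⟩ | ⟨h, h'⟩
      · exact (inj _ _ (by omega) (by omega) h).symm
      · have := inj _ _ (by omega) (by omega) h
        have := inj _ _ (by omega) (by omega) h'
        omega
    · exact absurd hij (hge _ h1)
    · exact absurd hij.symm (hge _ h2)
    · omega
  · intro (i : Fin _)
    dsimp only
    split_ifs with h
    · exact Or.inr (hg _ h).1
    · exact Or.inl rfl
  · intro (i : Fin _)
    have hi := i.2
    have hadd : (i + 1 : Fin (p.length + 1)).val = if i.val < p.length then i.val + 1 else 0 := by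
      rw [Fin.val_add_one]
      split_ifs with h1 h2 h2
      · rw [h1] at h2; simp at h2
      · rfl
      · rfl
      · exact absurd (Fin.ext (by simp; omega)) h1
    change G.ends (if i.val < p.length then g i.val else e)
      = s(p.getVert i.val, p.getVert (i + 1 : Fin (p.length + 1)).val)
    rw [hadd]
    split_ifs with h
    · exact (hg _ h).2
    · have : i.val = p.length := by omega
      rw [this, he, p.getVert_length, p.getVert_zero, Sym2.eq_swap]

lemma forest_count {V E : Type*} [Fintype V] [Fintype E] (G : Multigraph V E) (B : Set E) :
    ¬ G.EdgeCyc B → B.ncard + G.numComponentsEdges B = Nat.card V := by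
  induction B, B.toFinite using Set.Finite.induction_on with
  | empty => simp [comp_empty]
  | @insert e D he hD ih =>
    intro hc
    have hD' : ¬ G.EdgeCyc D := by
      rintro ⟨n, hn, f, hf, g, hg, hgB, h⟩
      exact hc ⟨n, hn, f, hf, g, hg, fun i => Or.inr (hgB i), h⟩
    have ih := ih hD'
    rw [Set.ncard_insert_of_notMem he hD]
    obtain ⟨u, v, h⟩ : ∃ u v, G.ends e = s(u, v) := by
      induction h : G.ends e using Sym2.ind with
      | _ u v => exact ⟨u, v, rfl⟩
    by_cases huv : Quot.mk (G.eRel D) u = Quot.mk (G.eRel D) v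
    · exact absurd (G.cyc_of_conn D e he u v h huv) hc
    · have := G.comp_insert_diff D e u v h huv
      omega

open Classical in
lemma degree_sum {V E : Type*} [Fintype V] [Fintype E] (G : Multigraph V E)
    (h3 : G.Trivalent) (A : Set V) :
    3 * A.ncard = (G.insideE A).ncard + (G.inc A).ncard := by
  have h1 : ∑ v ∈ A.toFinset, G.degree v = 3 * A.ncard := by
    rw [Finset.sum_congr rfl (fun v _ => h3 v), Set.ncard_eq_toFinset_card']
    simp [mul_comm]
  rw [← h1]
  unfold degree
  rw [Finset.sum_comm]
  have hc : ∀ S : Set E, S.ncard = ∑ e : E, if e ∈ S then 1 else 0 := by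
    intro S
    rw [Set.ncard_eq_toFinset_card', Finset.sum_boole]
    simp only [Nat.cast_id]
    congr 1
    ext; simp
  rw [hc, hc, ← Finset.sum_add_distrib]
  refine Finset.sum_congr rfl fun e _ => ?_
  have he : ∀ x y, (∃ v ∈ A, v ∈ s(x, y)) ↔ (x ∈ A ∨ y ∈ A) := by
    intro x y
    constructor
    · rintro ⟨v, hv, h⟩
      rcases Sym2.mem_iff.1 h with rfl | rfl
      · exact Or.inl hv
      · exact Or.inr hv
    · rintro (h | h)
      · exact ⟨x, h, by simp⟩
      · exact ⟨y, h, by simp⟩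
  obtain ⟨x, y, hxy⟩ : ∃ x y, G.ends e = s(x, y) := by
    induction h : G.ends e using Sym2.ind with
    | _ u v => exact ⟨u, v, rfl⟩
  have hm1 : e ∈ G.insideE A ↔ (x ∈ A ∧ y ∈ A) := by
    change (∀ v ∈ G.ends e, v ∈ A) ↔ _
    rw [hxy]
    simp
  have hm2 : e ∈ G.inc A ↔ (x ∈ A ∨ y ∈ A) := by
    change (∃ v ∈ A, v ∈ G.ends e) ↔ _
    rw [hxy]
    exact he x y
  simp only [hm1, hm2, hxy]
  have ht : ∀ v, (if s(x, y) = s(v, v) then 2 else if v ∈ s(x, y) then 1 else 0)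
      = (if x = v then 1 else 0) + (if y = v then 1 else 0) := by
    intro v
    by_cases hx : x = v <;> by_cases hy : y = v <;>
      simp [hx, hy, eq_comm]
  rw [Finset.sum_congr rfl (fun v _ => ht v), Finset.sum_add_distrib,
    Finset.sum_ite_eq, Finset.sum_ite_eq]
  by_cases hx : x ∈ A <;> by_cases hy : y ∈ A <;> simp [hx, hy]

end Multigraph

/-- For a connected trivalent finite graph `G` and an acyclic
`A ⊆ V`, `r*(δ(A)) = |A| + ω(A) - ω(V-A) + 1`. -/
theorem bondRank_inc_acyclic_formula {V E : Type*} [Fintype V] [Fintype E]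
    (G : Multigraph V E) (hG : G.Connected) (h3 : G.Trivalent)
    (A : Set V) (hA : G.Acyclic A) :
    (G.bondRank (G.inc A) : ℤ) =
      A.ncard + G.numComponentsSub A - G.numComponentsSub Aᶜ + 1 := by
  have h1 := G.degree_sum h3 A
  have h2 : ¬ G.EdgeCyc (G.insideE A) := by
    rintro ⟨n, hn, f, hf, g, hg, hgB, h⟩
    refine hA ⟨Set.range f, ?_, n, hn, f, hf, rfl, g, hg, h⟩
    rintro _ ⟨i, rfl⟩
    exact hgB i _ (by rw [h]; simp)
  have h4 := G.forest_count _ h2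
  have h5 := G.comp_inside A
  have h6 := G.comp_inside Aᶜ
  have h7 := G.comp_le_union (G.inc A)ᶜ (G.inc A)
  have h8 : A.ncard + Aᶜ.ncard = Nat.card V := Set.ncard_add_ncard_compl A
  have h9 : G.numComponentsEdges Set.univ = 1 := hG
  rw [Set.union_compl_self, h9, G.compl_inc_eq] at h7
  rw [compl_compl] at h6
  have h10 : G.numComponentsEdges (G.insideE Aᶜ) ≤ Nat.card V := by
    have := Nat.card_le_card_of_surjective _ (Quot.mk_surjective (r := G.eRel (G.insideE Aᶜ)))
    exact this
  have h11 : G.numComponentsEdges Set.univ ≤ Nat.card V := by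
    have := Nat.card_le_card_of_surjective _ (Quot.mk_surjective (r := G.eRel Set.univ))
    exact this
  unfold Multigraph.bondRank Multigraph.cycleRank
  rw [G.compl_inc_eq]
  omega
end

section
/- Let G be a connected trivalent finite graph. The graph curve matroid M_G is identically self-dual (i.e., M_G equals its dual matroid, so the complement of every basis is a basis) if and only if G is 2-edge-connected. -/
namespace Multigraph

section aux

variable {V E : Type*} [Fintype V] [Fintype E] (G : Multigraph V E)

/-- The class of a vertex in the spanning subgraph with edge set `X`. -/
abbrev Cls (X : Set E) : Type _ := Quot (fun u v : V => ∃ e ∈ X, G.ends e = s(u, v))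

/-- Class map. -/
def cls (X : Set E) (v : V) : G.Cls X := Quot.mk _ v

theorem cls_inv (X : Set E) (P : V → Prop)
    (hP : ∀ e ∈ X, ∀ u v, G.ends e = s(u, v) → (P u ↔ P v)) {u v : V}
    (h : G.cls X u = G.cls X v) : P u ↔ P v := by
  have : Quot.lift P (fun a b ⟨e, he, h⟩ => propext (hP e he a b h)) (G.cls X u) =
      Quot.lift P (fun a b ⟨e, he, h⟩ => propext (hP e he a b h)) (G.cls X v) := by rw [h]
  exact iff_of_eq this

theorem cls_edge {X : Set E} {e : E} (he : e ∈ X) {u v : V} (h : G.ends e = s(u, v)) :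
    G.cls X u = G.cls X v := Quot.sound ⟨e, he, h⟩

/-- Functions constant along the edges in `B`. -/
def K (B : Set E) : Submodule ℚ (V → ℚ) where
  carrier := {x | ∀ e ∈ B, ∀ u v, G.ends e = s(u, v) → x u = x v}
  add_mem' := by
    intro a b ha hb e he u v h
    simp [ha e he u v h, hb e he u v h]
  zero_mem' := by intro e he u v h; rfl
  smul_mem' := by
    intro c a ha e he u v h
    simp [ha e he u v h]

theorem finrank_K (B : Set E) : Module.finrank ℚ (G.K B) = G.numComponentsEdges B := by
  classical
  have : Fintype (G.Cls B) := Fintype.ofFinite _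
  have h1 : LinearMap.range (LinearMap.funLeft ℚ ℚ (G.cls B)) = G.K B := by
    ext x
    constructor
    · rintro ⟨y, rfl⟩ e he u v h
      simp [LinearMap.funLeft_apply, G.cls_edge he h]
    · intro hx
      refine ⟨Quot.lift x (fun a b ⟨e, he, h⟩ => hx e he a b h), ?_⟩
      ext v
      rfl
  have hinj : Function.Injective (LinearMap.funLeft ℚ ℚ (G.cls B)) :=
    LinearMap.funLeft_injective_of_surjective _ _ _ Quot.mk_surjective
  rw [← h1, LinearMap.finrank_range_of_inj hinj, Module.finrank_fintype_fun_eq_card,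
    numComponentsEdges, Nat.card_eq_fintype_card]

theorem nC_super (X Y : Set E) : G.numComponentsEdges X + G.numComponentsEdges Y ≤
    G.numComponentsEdges (X ∪ Y) + G.numComponentsEdges (X ∩ Y) := by
  simp only [← finrank_K]
  have h1 : G.K (X ∪ Y) = G.K X ⊓ G.K Y := by
    ext x
    constructor
    · intro h
      exact ⟨fun e he => h e (Or.inl he), fun e he => h e (Or.inr he)⟩
    · rintro ⟨h, h'⟩ e (he | he)
      · exact h e he
      · exact h' e he
  have h2 : G.K X ⊔ G.K Y ≤ G.K (X ∩ Y) := by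
    apply sup_le
    · exact fun x h e he => h e he.1
    · exact fun x h e he => h e he.2
  have h3 := Submodule.finrank_sup_add_finrank_inf_eq (G.K X) (G.K Y)
  have h4 := Submodule.finrank_mono h2
  rw [h1]; omega

theorem nC_lower (D : Set E) : Nat.card V ≤ G.numComponentsEdges D + D.ncard := by
  classical
  let L : (V → ℚ) →ₗ[ℚ] (D → ℚ) :=
    { toFun := fun x e => x (Quot.out (G.ends e)).1 - x (Quot.out (G.ends e)).2
      map_add' := by intro x y; ext e; simp; ring
      map_smul' := by intro c x; ext e; simp; ring }
  have hout : ∀ e, G.ends e = s((Quot.out (G.ends e)).1, (Quot.out (G.ends e)).2) := by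
    intro e
    exact (Quot.out_eq (G.ends e)).symm
  have hk : LinearMap.ker L = G.K D := by
    ext x
    constructor
    · intro h e he u v huv
      have h1 : x (Quot.out (G.ends e)).1 - x (Quot.out (G.ends e)).2 = 0 :=
        congrFun (LinearMap.mem_ker.1 h) ⟨e, he⟩
      have h2 := hout e
      rw [huv, Sym2.eq_iff] at h2
      rw [huv] at h1
      rcases h2 with ⟨h2, h3⟩ | ⟨h2, h3⟩
      · rw [← h2, ← h3] at h1; linarith
      · rw [← h2, ← h3] at h1; linarith
    · intro h
      rw [LinearMap.mem_ker]
      ext e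
      have := h e e.2 _ _ (hout e)
      simp [L, this]
  have h1 := LinearMap.finrank_range_add_finrank_ker L
  rw [hk, finrank_K, Module.finrank_fintype_fun_eq_card] at h1
  have h2 := Submodule.finrank_le (LinearMap.range L)
  rw [Module.finrank_fintype_fun_eq_card] at h2
  rw [Nat.card_eq_fintype_card, ← Nat.card_coe_set_eq, Nat.card_eq_fintype_card]
  omega

theorem nC_le (D : Set E) : G.numComponentsEdges D ≤ Nat.card V :=
  Nat.card_le_card_of_surjective (G.cls D) Quot.mk_surjective

theorem nC_empty : G.numComponentsEdges ∅ = Nat.card V := by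
  have := G.nC_lower ∅
  have := G.nC_le ∅
  simp at *
  omega

theorem bond_eq (hc : G.Connected) (X : Set E) :
    G.bondRank X + G.numComponentsEdges Xᶜ = X.ncard + 1 := by
  have h1 := G.nC_super X Xᶜ
  rw [Set.union_compl_self, Set.inter_compl_self, nC_empty] at h1
  have h2 := G.nC_lower X
  have h3 := G.nC_le Xᶜ
  unfold Connected at hc
  have h4 := G.nC_le Set.univ
  unfold bondRank cycleRank
  omega

theorem bond_mono (hc : G.Connected) {X Y : Set E} (h : X ⊆ Y) :
    G.bondRank X ≤ G.bondRank Y := by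
  have h1 := G.bond_eq hc X
  have h2 := G.bond_eq hc Y
  have h3 := G.nC_super Yᶜ (Y \ X)
  have e1 : Yᶜ ∪ (Y \ X) = Xᶜ := by
    ext e
    have := @h e
    simp only [Set.mem_union, Set.mem_compl_iff, Set.mem_diff]; tauto
  have e2 : Yᶜ ∩ (Y \ X) = ∅ := by
    ext e
    simp only [Set.mem_inter_iff, Set.mem_compl_iff, Set.mem_diff, Set.mem_empty_iff_false]; tauto
  rw [e1, e2, nC_empty] at h3
  have h4 := G.nC_lower (Y \ X)
  have h5 := Set.ncard_sdiff_add_ncard_of_subset h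
  omega

theorem bond_sub (hc : G.Connected) (X Y : Set E) :
    G.bondRank (X ∪ Y) + G.bondRank (X ∩ Y) ≤ G.bondRank X + G.bondRank Y := by
  have h1 := G.bond_eq hc X
  have h2 := G.bond_eq hc Y
  have h3 := G.bond_eq hc (X ∪ Y)
  have h4 := G.bond_eq hc (X ∩ Y)
  have h5 := G.nC_super Xᶜ Yᶜ
  rw [← Set.compl_inter, ← Set.compl_union] at h5
  have h6 := Set.ncard_union_add_ncard_inter X Y
  omega

/-- The rank function `r*(δ(A))`. -/
noncomputable def f (A : Set V) : ℕ := G.bondRank (G.inc A)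

theorem f_mono (hc : G.Connected) {A B : Set V} (h : A ⊆ B) : G.f A ≤ G.f B := by
  apply G.bond_mono hc
  rintro e ⟨v, hv, hve⟩
  exact ⟨v, h hv, hve⟩

theorem f_sub (hc : G.Connected) (A B : Set V) :
    G.f (A ∪ B) + G.f (A ∩ B) ≤ G.f A + G.f B := by
  have h1 := G.bond_sub hc (G.inc A) (G.inc B)
  have h2 : G.inc (A ∪ B) = G.inc A ∪ G.inc B := by
    ext e
    simp only [inc, Set.mem_setOf_eq, Set.mem_union]
    constructor
    · rintro ⟨v, hv | hv, h⟩
      · exact Or.inl ⟨v, hv, h⟩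
      · exact Or.inr ⟨v, hv, h⟩
    · rintro (⟨v, hv, h⟩ | ⟨v, hv, h⟩)
      · exact ⟨v, Or.inl hv, h⟩
      · exact ⟨v, Or.inr hv, h⟩
  have h3 : G.inc (A ∩ B) ⊆ G.inc A ∩ G.inc B := by
    rintro e ⟨v, hv, h⟩
    exact ⟨⟨v, hv.1, h⟩, ⟨v, hv.2, h⟩⟩
  have h4 := G.bond_mono hc h3
  unfold f
  rw [h2]; omega

/-- The edge cut of `A`. -/
def cut (A : Set V) : Set E := G.inc A ∩ G.inc Aᶜ

theorem handshake (h3 : G.Trivalent) (A : Set V) :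
    2 * (G.inc A).ncard = 3 * A.ncard + (G.cut A).ncard := by
  classical
  have hA : 3 * A.ncard = ∑ v ∈ A.toFinset, G.degree v := by
    rw [Finset.sum_congr rfl (fun v _ => h3 v), Finset.sum_const, Set.ncard_eq_toFinset_card',
      smul_eq_mul, mul_comm]
  unfold degree at hA
  rw [Finset.sum_comm] at hA
  have h1 : ∀ X : Set E, X.ncard = ∑ e : E, if e ∈ X then 1 else 0 := by
    intro X
    rw [Set.ncard_eq_toFinset_card', Finset.sum_boole]
    simp
  rw [hA, h1, h1, Finset.mul_sum, ← Finset.sum_add_distrib]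
  refine Finset.sum_congr rfl (fun e _ => ?_)
  obtain ⟨a, b, hab⟩ : ∃ a b, G.ends e = s(a, b) := by
    induction h : G.ends e using Sym2.ind with
    | _ a b => exact ⟨a, b, rfl⟩
  have hinc : ∀ S : Set V, e ∈ G.inc S ↔ a ∈ S ∨ b ∈ S := by
    intro S
    simp only [inc, Set.mem_setOf_eq, hab, Sym2.mem_iff]
    constructor
    · rintro ⟨v, hv, rfl | rfl⟩ <;> tauto
    · rintro (h | h)
      · exact ⟨a, h, Or.inl rfl⟩
      · exact ⟨b, h, Or.inr rfl⟩
  have hterm : ∀ v : V, (if G.ends e = s(v, v) then 2 else if v ∈ G.ends e then 1 else 0) =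
      (if v = a then 1 else 0) + (if v = b then 1 else 0) := by
    intro v
    rw [hab]
    by_cases h1 : v = a <;> by_cases h2 : v = b
    · subst h1; subst h2; simp
    · subst h1; simp [h2, Ne.symm h2]
    · subst h2; simp [h1, Ne.symm h1]
    · simp [h1, h2, Ne.symm h1]
  rw [Finset.sum_congr rfl (fun v _ => hterm v), Finset.sum_add_distrib, Finset.sum_ite_eq',
    Finset.sum_ite_eq']
  simp only [cut, Set.mem_inter_iff, hinc, Set.mem_toFinset, Set.mem_compl_iff]
  by_cases h1 : a ∈ A <;> by_cases h2 : b ∈ A <;> simp [h1, h2]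

theorem f_eq (h3 : G.Trivalent) (hc : G.Connected) (A : Set V) :
    2 * G.f A + 2 * G.numComponentsEdges (G.inc A)ᶜ = 3 * A.ncard + (G.cut A).ncard + 2 := by
  have h1 := G.bond_eq hc (G.inc A)
  have h2 := G.handshake h3 A
  unfold f; omega

open Classical in
/-- Components of the complement of `A`. -/
noncomputable def comps (A : Set V) : Set (G.Cls (G.inc A)ᶜ) := (G.cls (G.inc A)ᶜ '' A)ᶜ

theorem cls_eq_mem {A : Set V} {a b : V} (ha : a ∈ A)
    (h : G.cls (G.inc A)ᶜ a = G.cls (G.inc A)ᶜ b) : a = b := by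
  have := (G.cls_inv (G.inc A)ᶜ (fun x => x = a) ?_ h).1 rfl
  · exact this.symm
  · intro e he u v huv
    have h1 : u ≠ a := by
      rintro rfl; exact he ⟨u, ha, by simp [huv]⟩
    have h2 : v ≠ a := by
      rintro rfl; exact he ⟨v, ha, by simp [huv]⟩
    simp [h1, h2]

theorem nC_comps (A : Set V) :
    G.numComponentsEdges (G.inc A)ᶜ = A.ncard + (G.comps A).ncard := by
  have h1 : (G.cls (G.inc A)ᶜ '' A).ncard = A.ncard :=
    Set.ncard_image_of_injOn (fun a ha b _ h => G.cls_eq_mem ha h)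
  have h2 := Set.ncard_add_ncard_compl (G.cls (G.inc A)ᶜ '' A)
  rw [← h1]
  unfold comps
  rw [h2]; rfl

theorem mem_comps {A : Set V} {v : V} : G.cls (G.inc A)ᶜ v ∈ G.comps A ↔ v ∉ A := by
  unfold comps
  constructor
  · intro h hv
    exact h ⟨v, hv, rfl⟩
  · rintro h ⟨a, ha, hav⟩
    exact h (G.cls_eq_mem ha hav ▸ ha)

/-- The vertex set of a class. -/
def fib (A : Set V) (x : G.Cls (G.inc A)ᶜ) : Set V := {v | G.cls (G.inc A)ᶜ v = x}

theorem fib_sub {A : Set V} {x} (hx : x ∈ G.comps A) : G.fib A x ⊆ Aᶜ := by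
  rintro v rfl
  exact G.mem_comps.1 hx

theorem fib_nonempty {A : Set V} (x) : (G.fib A x).Nonempty := by
  obtain ⟨v, hv⟩ := Quot.mk_surjective x
  exact ⟨v, hv⟩

/-- A cut edge of a component joins the component to `A`. -/
theorem cut_fib {A : Set V} {x} (hx : x ∈ G.comps A) {e : E} (he : e ∈ G.cut (G.fib A x)) :
    ∃ u v, G.ends e = s(u, v) ∧ u ∈ G.fib A x ∧ v ∈ A := by
  obtain ⟨⟨u, hu, hue⟩, ⟨v, hv, hve⟩⟩ := he
  have huv : u ≠ v := by rintro rfl; exact hv hu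
  have hends : G.ends e = s(u, v) := (Sym2.mem_and_mem_iff huv).1 ⟨hue, hve⟩
  refine ⟨u, v, hends, hu, ?_⟩
  by_contra hvA
  have hinc : e ∈ (G.inc A)ᶜ := by
    rintro ⟨w, hw, hwe⟩
    rw [hends, Sym2.mem_iff] at hwe
    rcases hwe with rfl | rfl
    · exact G.fib_sub hx hu hw
    · exact hvA hw
  have := G.cls_edge hinc hends
  exact hv (this.symm.trans hu)

theorem sum_ncard_le {α ι : Type*} [Finite α] (T : Finset ι) (F : ι → Set α) (S : Set α)
    (hsub : ∀ i ∈ T, F i ⊆ S) (hdis : ∀ i ∈ T, ∀ j ∈ T, ∀ a, a ∈ F i → a ∈ F j → i = j) :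
    ∑ i ∈ T, (F i).ncard ≤ S.ncard := by
  classical
  have : Fintype α := Fintype.ofFinite α
  simp only [Set.ncard_eq_toFinset_card']
  rw [← Finset.card_biUnion]
  · apply Finset.card_le_card
    intro a ha
    simp only [Finset.mem_biUnion, Set.mem_toFinset] at ha ⊢
    obtain ⟨i, hi, h⟩ := ha
    exact hsub i hi h
  · intro i hi j hj hij
    refine Finset.disjoint_left.2 ?_
    intro a h1 h2
    exact hij (hdis i hi j hj a (by simpa using h1) (by simpa using h2))

theorem ncard_le_sum {α ι : Type*} [Finite α] (T : Finset ι) (F : ι → Set α) (S : Set α)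
    (hsub : ∀ a ∈ S, ∃ i ∈ T, a ∈ F i) :
    S.ncard ≤ ∑ i ∈ T, (F i).ncard := by
  classical
  have : Fintype α := Fintype.ofFinite α
  simp only [Set.ncard_eq_toFinset_card']
  refine le_trans (Finset.card_le_card ?_) Finset.card_biUnion_le
  intro a ha
  obtain ⟨i, hi, h⟩ := hsub a (by simpa using ha)
  simp only [Finset.mem_biUnion, Set.mem_toFinset]
  exact ⟨i, hi, h⟩

/-- The components as a finset. -/
noncomputable def compsF (A : Set V) : Finset (G.Cls (G.inc A)ᶜ) :=
  (Set.toFinite (G.comps A)).toFinset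

theorem mem_compsF {A : Set V} {x} : x ∈ G.compsF A ↔ x ∈ G.comps A := by
  simp [compsF]

theorem card_compsF (A : Set V) : (G.compsF A).card = (G.comps A).ncard := by
  rw [compsF, Set.ncard_eq_toFinset_card]

theorem sum_cut_le (A : Set V) :
    ∑ x ∈ G.compsF A, (G.cut (G.fib A x)).ncard ≤ (G.cut A).ncard := by
  apply sum_ncard_le
  · intro x hx e he
    rw [mem_compsF] at hx
    obtain ⟨u, v, h, hu, hv⟩ := G.cut_fib hx he
    exact ⟨⟨v, hv, by simp [h]⟩, ⟨u, G.fib_sub hx hu, by simp [h]⟩⟩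
  · intro x hx y hy e he he'
    rw [mem_compsF] at hx hy
    obtain ⟨u, v, h, hu, hv⟩ := G.cut_fib hx he
    obtain ⟨u', v', h', hu', hv'⟩ := G.cut_fib hy he'
    rw [h, Sym2.eq_iff] at h'
    rcases h' with ⟨rfl, rfl⟩ | ⟨rfl, rfl⟩
    · exact hu.symm.trans hu'
    · exact absurd hv' (G.fib_sub hx hu)

theorem sum_fib_le (A : Set V) :
    ∑ x ∈ G.compsF A, (G.fib A x).ncard ≤ Aᶜ.ncard := by
  apply sum_ncard_le
  · intro x hx
    exact G.fib_sub (G.mem_compsF.1 hx)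
  · intro x hx y hy v hv hv'
    exact hv.symm.trans hv'

/-- Upper bound on `f` for proper subsets. -/
theorem f_upper (h3 : G.Trivalent) (hc : G.Connected) {A : Set V} (hA : A ≠ Set.univ) :
    2 * G.f A ≤ A.ncard + (G.cut A).ncard := by
  have h1 := G.f_eq h3 hc A
  rw [nC_comps] at h1
  obtain ⟨v, hv⟩ := (Set.ne_univ_iff_exists_notMem _).1 hA
  have h2 : 0 < (G.comps A).ncard := (Set.ncard_pos).2 ⟨_, G.mem_comps.2 hv⟩
  omega

theorem f_univ (h3 : G.Trivalent) (hc : G.Connected) :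
    2 * G.f Set.univ ≤ Nat.card V + 2 := by
  have h1 := G.f_eq h3 hc Set.univ
  rw [nC_comps] at h1
  have : G.cut (Set.univ : Set V) = ∅ := by
    ext e; simp [cut, inc]
  rw [this, Set.ncard_empty, Set.ncard_univ] at h1
  omega

theorem of_cut_disj {X : Set E} (hX : G.numComponentsEdges X = 1) {D : Set V}
    (hne : D.Nonempty) (h : ∀ e ∈ G.cut D, e ∉ X) : D = Set.univ := by
  obtain ⟨a, ha⟩ := hne
  rw [Set.eq_univ_iff_forall]
  intro b
  have hs : Subsingleton (G.Cls X) := (Nat.card_eq_one_iff_unique.1 hX).1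
  refine (G.cls_inv X (· ∈ D) ?_ (hs.elim (G.cls X a) (G.cls X b))).1 ha
  intro e he u v huv
  by_contra hcon
  apply h e _ he
  by_cases hu : u ∈ D
  · have hv : v ∉ D := fun hv => hcon ⟨fun _ => hv, fun _ => hu⟩
    exact ⟨⟨u, hu, by simp [huv]⟩, ⟨v, hv, by simp [huv]⟩⟩
  · have hv : v ∈ D := by
      by_contra hv
      exact hcon ⟨fun h => absurd h hu, fun h => absurd h hv⟩
    exact ⟨⟨v, hv, by simp [huv]⟩, ⟨u, hu, by simp [huv]⟩⟩

theorem two_le_cut (h2 : G.TwoEdgeConnected) {D : Set V} (hne : D.Nonempty)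
    (hD : D ≠ Set.univ) : 2 ≤ (G.cut D).ncard := by
  by_contra hlt
  have hle : (G.cut D).ncard ≤ 1 := by omega
  rcases Set.eq_empty_or_nonempty (G.cut D) with h0 | ⟨e, he⟩
  · exact hD (G.of_cut_disj h2.1 hne (by simp [h0]))
  · refine hD (G.of_cut_disj (h2.2 e) hne (fun e' he' hmem => hmem ?_))
    exact (Set.ncard_le_one).1 hle e' he' e he

theorem f_lower (h3 : G.Trivalent) (h2 : G.TwoEdgeConnected) {A : Set V} (hA : A.Nonempty) :
    A.ncard + 2 ≤ 2 * G.f A := by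
  have h1 := G.f_eq h3 h2.1 A
  rw [nC_comps] at h1
  have h4 := G.sum_cut_le A
  have h5 : ∑ x ∈ G.compsF A, 2 ≤ ∑ x ∈ G.compsF A, (G.cut (G.fib A x)).ncard := by
    refine Finset.sum_le_sum (fun x hx => ?_)
    refine G.two_le_cut h2 (G.fib_nonempty x) ?_
    intro hu
    obtain ⟨a, ha⟩ := hA
    exact G.fib_sub (G.mem_compsF.1 hx) (hu ▸ Set.mem_univ a) ha
  rw [Finset.sum_const, card_compsF, smul_eq_mul] at h5
  omega

theorem indep_iff (A : Set V) :
    G.IndepMG A ↔ ∀ A' ⊆ A, A'.Nonempty → A'.ncard < G.f A' := by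
  constructor
  · intro h A' hA' hne
    by_contra hlt
    apply h
    obtain ⟨C, hC, hmin⟩ := Set.Finite.exists_le_minimal
      (Set.toFinite {C : Set V | C.Nonempty ∧ G.f C ≤ C.ncard}) (a := A') ⟨hne, by omega⟩
    refine ⟨C, hC.trans hA', hmin.prop.1, hmin.prop.2, ?_⟩
    intro D hD hDne
    by_contra hcon
    exact hD.2 (hmin.le_of_le (y := D) ⟨hDne, not_lt.1 hcon⟩ hD.1)
  · rintro h ⟨C, hC, hne, hle, -⟩
    exact absurd (h C hC hne) (not_lt.2 hle)

theorem indep_le (h3 : G.Trivalent) (hc : G.Connected) {I : Set V} (hI : G.IndepMG I) :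
    2 * I.ncard ≤ Nat.card V := by
  rcases Set.eq_empty_or_nonempty I with rfl | hne
  · simp
  · have h1 := (G.indep_iff I).1 hI I subset_rfl hne
    have h2 := G.f_mono hc (Set.subset_univ I)
    have h4 := G.f_univ h3 hc
    omega

theorem compl_indep (h3 : G.Trivalent) (h2 : G.TwoEdgeConnected) {B : Set V}
    (hB : G.IndepMG B) (hcard : 2 * B.ncard = Nat.card V) : G.IndepMG Bᶜ := by
  rw [indep_iff] at hB ⊢
  intro A hA hne
  by_contra hlt
  rw [not_lt] at hlt
  have hc := h2.1
  have h1 := G.f_eq h3 hc A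
  rw [nC_comps] at h1
  have hs : B.ncard ≤ ∑ x ∈ G.compsF A, (B ∩ G.fib A x).ncard := by
    apply ncard_le_sum
    intro v hv
    refine ⟨G.cls _ v, ?_, hv, rfl⟩
    rw [mem_compsF, mem_comps]
    exact fun h => hA h hv
  have hterm : ∑ x ∈ G.compsF A, (2 * (B ∩ G.fib A x).ncard + 2) ≤
      ∑ x ∈ G.compsF A, ((G.fib A x).ncard + (G.cut (G.fib A x)).ncard) := by
    refine Finset.sum_le_sum (fun x hx => ?_)
    rw [mem_compsF] at hx
    have hnu : G.fib A x ≠ Set.univ := by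
      intro hu
      obtain ⟨a, ha⟩ := hne
      exact G.fib_sub hx (hu ▸ Set.mem_univ a) ha
    rcases Set.eq_empty_or_nonempty (B ∩ G.fib A x) with h0 | h0
    · rw [h0, Set.ncard_empty]
      have := G.two_le_cut h2 (G.fib_nonempty x) hnu
      omega
    · have i1 := hB _ Set.inter_subset_left h0
      have i2 := G.f_mono hc (Set.inter_subset_right : B ∩ G.fib A x ⊆ G.fib A x)
      have i3 := G.f_upper h3 hc hnu
      omega
  rw [Finset.sum_add_distrib, Finset.sum_add_distrib, ← Finset.mul_sum, Finset.sum_const,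
    card_compsF, smul_eq_mul] at hterm
  have h5 := G.sum_cut_le A
  have h6 := G.sum_fib_le A
  have h7 := Set.ncard_add_ncard_compl A
  omega

theorem maximal_card (h3 : G.Trivalent) (h2 : G.TwoEdgeConnected) {I : Set V}
    (hI : G.IsBasisMG I) : Nat.card V ≤ 2 * I.ncard := by
  have hc := h2.1
  have hind := (G.indep_iff I).1 hI.1
  let tight : Set V → Prop := fun A => A.Nonempty ∧ G.f A ≤ (A ∩ I).ncard + 1
  have tcard : ∀ A, tight A → A.ncard ≤ 2 * (A ∩ I).ncard := by
    intro A hA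
    have := G.f_lower h3 h2 hA.1
    have := hA.2
    omega
  have tunion : ∀ A B, tight A → tight B → (A ∩ B).Nonempty → tight (A ∪ B) := by
    intro A B hA hB hAB
    refine ⟨hA.1.mono Set.subset_union_left, ?_⟩
    have h1 := G.f_sub hc A B
    have h4 : ((A ∩ B) ∩ I).ncard + 1 ≤ G.f (A ∩ B) := by
      rcases Set.eq_empty_or_nonempty ((A ∩ B) ∩ I) with h0 | h0
      · rw [h0, Set.ncard_empty]
        have := G.f_lower h3 h2 hAB
        omega
      · have i1 := hind _ Set.inter_subset_right h0
        have i2 := G.f_mono hc (Set.inter_subset_left : (A ∩ B) ∩ I ⊆ A ∩ B)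
        omega
    have h5 := Set.ncard_union_add_ncard_inter (A ∩ I) (B ∩ I)
    rw [← Set.union_inter_distrib_right, ← Set.inter_inter_distrib_right] at h5
    have := hA.2
    have := hB.2
    omega
  have tcover : ∀ v, v ∉ I → ∃ A, tight A ∧ v ∈ A := by
    intro v hv
    have hdep : ¬ G.IndepMG (insert v I) := by
      intro h
      have := hI.2 _ h (Set.subset_insert v I)
      exact hv (this ▸ Set.mem_insert v I)
    rw [indep_iff] at hdep
    push Not at hdep
    obtain ⟨A, hA, hne, hle⟩ := hdep
    refine ⟨A, ⟨hne, hle.trans ?_⟩, ?_⟩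
    · have : A ⊆ insert v (A ∩ I) := by
        intro a ha
        rcases hA ha with h | h
        · exact Or.inl h
        · exact Or.inr ⟨ha, h⟩
      exact (Set.ncard_le_ncard this).trans (Set.ncard_insert_le _ _)
    · by_contra hvA
      have : A ⊆ I := by
        intro a ha
        rcases hA ha with rfl | h
        · exact absurd ha hvA
        · exact h
      have := hind A this hne
      omega
  let sat : Set V → Prop := fun U =>
    U.ncard ≤ 2 * (U ∩ I).ncard ∧ ∀ A, tight A → (A ∩ U).Nonempty → A ⊆ U
  have hadd : ∀ U M : Set V, Disjoint U M → U.ncard ≤ 2 * (U ∩ I).ncard →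
      M.ncard ≤ 2 * (M ∩ I).ncard → (U ∪ M).ncard ≤ 2 * ((U ∪ M) ∩ I).ncard := by
    intro U M hd hU hM
    rw [Set.ncard_union_eq hd, Set.union_inter_distrib_right, Set.ncard_union_eq]
    · omega
    · exact hd.mono Set.inter_subset_left Set.inter_subset_left
  obtain ⟨U, -, hU⟩ := Set.Finite.exists_le_maximal
    (Set.toFinite {U : Set V | sat U}) (a := ∅) ⟨by simp, by simp⟩
  have hUu : U = Set.univ := by
    rw [Set.eq_univ_iff_forall]
    intro v
    by_contra hv
    obtain ⟨hU1, hU2⟩ := hU.prop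
    by_cases hex : ∃ A, tight A ∧ v ∈ A
    · obtain ⟨A, hA, hvA⟩ := hex
      obtain ⟨M, hAM, hM⟩ := Set.Finite.exists_le_maximal
        (Set.toFinite {A : Set V | tight A}) (a := A) hA
      have hvM : v ∈ M := hAM hvA
      have hdis : Disjoint U M := by
        rw [Set.disjoint_iff_inter_eq_empty]
        by_contra hcon
        rw [← ne_eq, ← Set.nonempty_iff_ne_empty, Set.inter_comm] at hcon
        exact hv (hU2 M hM.prop hcon hvM)
      have hs : sat (U ∪ M) := by
        refine ⟨hadd U M hdis hU1 (tcard M hM.prop), ?_⟩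
        rintro A hA ⟨a, haA, haU | haM⟩
        · exact (hU2 A hA ⟨a, haA, haU⟩).trans Set.subset_union_left
        · have h1 := tunion M A hM.prop hA ⟨a, haM, haA⟩
          have h4 : M ∪ A ⊆ M := hM.le_of_ge h1 Set.subset_union_left
          exact (Set.subset_union_right.trans h4).trans Set.subset_union_right
      exact hv (hU.le_of_ge hs Set.subset_union_left (Or.inr hvM))
    · have hvI : v ∈ I := by
        by_contra h
        exact hex (tcover v h)
      have hs : sat (U ∪ {v}) := by
        refine ⟨hadd U {v} (by simpa using hv) hU1 ?_, ?_⟩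
        · rw [Set.inter_eq_left.2 (by simpa using hvI)]
          omega
        · rintro A hA ⟨a, haA, haU | haM⟩
          · exact (hU2 A hA ⟨a, haA, haU⟩).trans Set.subset_union_left
          · rw [Set.mem_singleton_iff] at haM
            exact absurd ⟨A, hA, haM ▸ haA⟩ hex
      exact hv (hU.le_of_ge hs Set.subset_union_left (Or.inr rfl))
  have := hU.prop.1
  rw [hUu, Set.univ_inter, Set.ncard_univ] at this
  exact this

theorem basis_iff (h3 : G.Trivalent) (h2 : G.TwoEdgeConnected) (B : Set V) :
    G.IsBasisMG B ↔ G.IndepMG B ∧ 2 * B.ncard = Nat.card V := by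
  constructor
  · intro h
    have := G.maximal_card h3 h2 h
    have := G.indep_le h3 h2.1 h.1
    exact ⟨h.1, by omega⟩
  · rintro ⟨h, hcard⟩
    refine ⟨h, fun I hI hBI => ?_⟩
    have := G.indep_le h3 h2.1 hI
    exact (Set.eq_of_subset_of_ncard_le hBI (by omega)).symm

theorem basis_compl (h3 : G.Trivalent) (h2 : G.TwoEdgeConnected) {B : Set V}
    (hB : G.IsBasisMG B) : G.IsBasisMG Bᶜ := by
  rw [basis_iff G h3 h2] at hB ⊢
  refine ⟨G.compl_indep h3 h2 hB.1 hB.2, ?_⟩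
  have := Set.ncard_add_ncard_compl B
  omega

theorem indep_lt_of_cut (h3 : G.Trivalent) (hc : G.Connected) {A : Set V} (hne : A.Nonempty)
    (hA : A ≠ Set.univ) (hcut : (G.cut A).ncard ≤ 1) {I : Set V} (hI : G.IndepMG I) :
    2 * (I ∩ A).ncard + 1 ≤ A.ncard := by
  have h1 : 0 < A.ncard := (Set.ncard_pos).2 hne
  rcases Set.eq_empty_or_nonempty (I ∩ A) with h0 | h0
  · rw [h0, Set.ncard_empty]; omega
  · have i1 := (G.indep_iff I).1 hI _ Set.inter_subset_left h0
    have i2 := G.f_mono hc (Set.inter_subset_right : I ∩ A ⊆ A)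
    have i3 := G.f_upper h3 hc hA
    omega

theorem not_selfDual (h3 : G.Trivalent) (hc : G.Connected) {e : E}
    (he : G.numComponentsEdges {e}ᶜ ≠ 1) :
    ¬ (∀ B : Set V, G.IsBasisMG B ↔ G.IsBasisMG Bᶜ) := by
  intro hsd
  have hV : Nonempty V := by
    have h := (Nat.card_eq_one_iff_unique.1 hc).2
    obtain ⟨x⟩ := h
    obtain ⟨v, -⟩ := Quot.mk_surjective x
    exact ⟨v⟩
  obtain ⟨a⟩ := hV
  let A : Set V := {v | G.cls {e}ᶜ v = G.cls {e}ᶜ a}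
  have hAne : A.Nonempty := ⟨a, rfl⟩
  have hAu : A ≠ Set.univ := by
    intro hu
    apply he
    refine Nat.card_eq_one_iff_unique.2 ⟨⟨?_⟩, ⟨G.cls _ a⟩⟩
    intro x y
    obtain ⟨u, rfl⟩ := Quot.mk_surjective x
    obtain ⟨v, rfl⟩ := Quot.mk_surjective y
    have h1 : u ∈ A := hu ▸ Set.mem_univ u
    have h2 : v ∈ A := hu ▸ Set.mem_univ v
    exact Eq.trans h1 (Eq.symm h2)
  have hcutA : (G.cut A).ncard ≤ 1 := by
    have : G.cut A ⊆ {e} := by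
      rintro e' ⟨⟨u, hu, hue⟩, ⟨v, hv, hve⟩⟩
      by_contra hcon
      have huv : u ≠ v := by rintro rfl; exact hv hu
      have hends : G.ends e' = s(u, v) := (Sym2.mem_and_mem_iff huv).1 ⟨hue, hve⟩
      have h1 : G.cls {e}ᶜ u = G.cls {e}ᶜ v := G.cls_edge hcon hends
      exact hv (h1.symm.trans hu)
    exact (Set.ncard_le_ncard this).trans (by simp)
  have hcutAc : (G.cut Aᶜ).ncard ≤ 1 := by
    have : G.cut Aᶜ = G.cut A := by
      unfold cut; rw [compl_compl, Set.inter_comm]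
    rwa [this]
  have hAcne : Aᶜ.Nonempty := Set.nonempty_compl.2 hAu
  have hAcu : Aᶜ ≠ Set.univ := by
    intro h
    rw [Set.compl_univ_iff] at h
    exact hAne.ne_empty h
  have key : ∀ I, G.IndepMG I → 2 * I.ncard + 2 ≤ Nat.card V := by
    intro I hI
    have h1 := G.indep_lt_of_cut h3 hc hAne hAu hcutA hI
    have h2 := G.indep_lt_of_cut h3 hc hAcne hAcu hcutAc hI
    have h4 := Set.ncard_add_ncard_compl A
    have h5 := Set.ncard_inter_add_ncard_sdiff_eq_ncard I A
    rw [Set.diff_eq] at h5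
    omega
  have h0 : G.IndepMG (∅ : Set V) := by
    rw [indep_iff]
    intro A' hA' hne
    exact absurd (Set.subset_empty_iff.1 hA') hne.ne_empty
  obtain ⟨B, -, hB⟩ := Set.Finite.exists_le_maximal
    (Set.toFinite {I : Set V | G.IndepMG I}) (a := ∅) h0
  have hbas : G.IsBasisMG B :=
    ⟨hB.prop, fun I hI h => Set.Subset.antisymm (hB.le_of_ge hI h) h⟩
  have h1 := key B hbas.1
  have h2 := key Bᶜ ((hsd B).1 hbas).1
  have h4 := Set.ncard_add_ncard_compl B
  omega

end aux

end Multigraph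

/-- For a connected trivalent finite graph `G`, the graph curve
matroid `M_G` is identically self-dual (the complement of every basis is a
basis, i.e. `M_G` equals its dual) iff `G` is 2-edge-connected. -/
theorem graphCurveMatroid_selfDual_iff {V E : Type*} [Fintype V] [Fintype E]
    (G : Multigraph V E) (h3 : G.Trivalent) (hconn : G.Connected) :
    (∀ B : Set V, G.IsBasisMG B ↔ G.IsBasisMG Bᶜ) ↔ G.TwoEdgeConnected := by
  constructor
  · intro h
    refine ⟨hconn, fun e => ?_⟩
    by_contra he
    exact G.not_selfDual h3 hconn he h
  · intro h2 B
    refine ⟨G.basis_compl h3 h2, fun h => ?_⟩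
    have := G.basis_compl h3 h2 h
    rwa [compl_compl] at this
end

section
/- Let G₁ = (V₁,E₁) and G₂ = (V₂,E₂) be trivalent, 2-edge-connected finite graphs, with edges (a₁,b₁) ∈ E₁ and (a₂,b₂) ∈ E₂, and let G be obtained from the disjoint union G₁ ⊔ G₂ by removing these two edges and adding the edges (a₁,a₂) and (b₁,b₂). Then the graph curve matroid of G equals the direct sum M_{G₁} ⊕ M_{G₂}. -/
open Classical in
/-- The 2-switch of the disjoint union of `G₁` and `G₂` along edges
`e₁ = (a₁, b₁)` of `G₁` and `e₂ = (a₂, b₂)` of `G₂`: these two edges are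
replaced by the edges `(a₁, a₂)` and `(b₁, b₂)`. -/
noncomputable def Multigraph.twoSwitch {V₁ E₁ V₂ E₂ : Type*}
    (G₁ : Multigraph V₁ E₁) (G₂ : Multigraph V₂ E₂)
    (e₁ : E₁) (e₂ : E₂) (a₁ b₁ : V₁) (a₂ b₂ : V₂) :
    Multigraph (V₁ ⊕ V₂) (E₁ ⊕ E₂) :=
  ⟨Sum.elim
    (fun e => if e = e₁ then s(Sum.inl a₁, Sum.inr a₂) else (G₁.ends e).map Sum.inl)
    (fun e => if e = e₂ then s(Sum.inl b₁, Sum.inr b₂) else (G₂.ends e).map Sum.inr)⟩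

namespace Multigraph

/-- Merging two classes of a quotient. -/
theorem card_quot_merge {V : Type*} [Finite V] (r r' : V → V → Prop) (u v : V)
    (h1 : ∀ x y, r x y → r' x y) (h2 : r' u v)
    (h3 : ∀ x y, r' x y → r x y ∨ (x = u ∧ y = v) ∨ (x = v ∧ y = u)) :
    (Quot.mk r u = Quot.mk r v → Nat.card (Quot r') = Nat.card (Quot r)) ∧
    (Quot.mk r u ≠ Quot.mk r v → Nat.card (Quot r') + 1 = Nat.card (Quot r)) := by
  classical
  constructor
  · intro h
    refine Nat.card_congr ⟨Quot.lift (fun x => Quot.mk r x) ?_,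
      Quot.lift (fun x => Quot.mk r' x) (fun x y hxy => Quot.sound (h1 x y hxy)), ?_, ?_⟩
    · intro x y hxy
      rcases h3 x y hxy with h' | ⟨rfl, rfl⟩ | ⟨rfl, rfl⟩
      · exact Quot.sound h'
      · exact h
      · exact h.symm
    · rintro ⟨x⟩; rfl
    · rintro ⟨x⟩; rfl
  · intro h
    have e : Quot r' ≃ {q : Quot r // q ≠ Quot.mk r v} := by
      refine ⟨Quot.lift (fun x => if hx : Quot.mk r x = Quot.mk r v then ⟨Quot.mk r u, h⟩
          else ⟨Quot.mk r x, hx⟩) ?_,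
        fun q => Quot.lift (fun x => Quot.mk r' x) (fun x y hxy => Quot.sound (h1 x y hxy)) q.1,
        ?_, ?_⟩
      · intro x y hxy
        rcases h3 x y hxy with h' | ⟨rfl, rfl⟩ | ⟨rfl, rfl⟩
        · have : Quot.mk r x = Quot.mk r y := Quot.sound h'
          simp [this]
        · simp [h]
        · simp [h]
      · rintro ⟨x⟩
        by_cases hx : Quot.mk r x = Quot.mk r v
        · have e1 : Quot.mk r' x = Quot.mk r' v := by
            have := congrArg (Quot.lift (fun x => Quot.mk r' x)
              (fun x y hxy => Quot.sound (h1 x y hxy))) hx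
            exact this
          have e2 : Quot.mk r' u = Quot.mk r' v := Quot.sound h2
          simp only [hx, dite_true]
          exact e2.trans e1.symm
        · simp only [hx, dite_false]
      · rintro ⟨⟨x⟩, hx⟩
        have hx' : ¬ Quot.mk r x = Quot.mk r v := hx
        simp only [hx', dite_false]
    rw [Nat.card_congr e]
    have := Set.ncard_add_ncard_compl ({Quot.mk r v} : Set (Quot r))
    rw [Set.ncard_singleton] at this
    have h' : Nat.card {q : Quot r // q ≠ Quot.mk r v} = ({Quot.mk r v}ᶜ : Set (Quot r)).ncard := rfl
    omega

/-- Quotient of a disjoint union. -/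
def quotSum {V₁ V₂ : Type*} (r₁ : V₁ → V₁ → Prop) (r₂ : V₂ → V₂ → Prop) :
    Quot (Sum.LiftRel r₁ r₂) ≃ Quot r₁ ⊕ Quot r₂ where
  toFun := Quot.lift (Sum.map (Quot.mk r₁) (Quot.mk r₂)) (by
    rintro x y (h | h)
    · simp [Quot.sound h]
    · simp [Quot.sound h])
  invFun := Sum.elim
    (Quot.lift (fun x => Quot.mk _ (Sum.inl x)) (fun x y h => Quot.sound (Sum.LiftRel.inl h)))
    (Quot.lift (fun x => Quot.mk _ (Sum.inr x)) (fun x y h => Quot.sound (Sum.LiftRel.inr h)))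
  left_inv := by rintro ⟨x | x⟩ <;> rfl
  right_inv := by rintro (x | x) <;> induction x using Quot.ind <;> rfl

open Classical in
/-- Component count of a disjoint union with two possible crossing edges. -/
theorem card_quot_cross {V₁ V₂ : Type*} [Finite V₁] [Finite V₂]
    (r₁ : V₁ → V₁ → Prop) (r₂ : V₂ → V₂ → Prop) (a₁ b₁ : V₁) (a₂ b₂ : V₂) (P Q : Prop)
    (R : V₁ ⊕ V₂ → V₁ ⊕ V₂ → Prop)
    (hR : ∀ x y, R x y ↔ Sum.LiftRel r₁ r₂ x y
      ∨ (P ∧ s(Sum.inl a₁, Sum.inr a₂) = s(x, y)) ∨ (Q ∧ s(Sum.inl b₁, Sum.inr b₂) = s(x, y))) :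
    Nat.card (Quot R) + (if P then 1 else 0) +
      (if Q ∧ ¬ (P ∧ Quot.mk r₁ a₁ = Quot.mk r₁ b₁ ∧ Quot.mk r₂ a₂ = Quot.mk r₂ b₂) then 1 else 0)
      = Nat.card (Quot r₁) + Nat.card (Quot r₂) := by
  set R0 := Sum.LiftRel r₁ r₂ with hR0
  set R1 : V₁ ⊕ V₂ → V₁ ⊕ V₂ → Prop :=
    fun x y => R0 x y ∨ (P ∧ s(Sum.inl a₁, Sum.inr a₂) = s(x, y)) with hR1
  have c0 : Nat.card (Quot R0) = Nat.card (Quot r₁) + Nat.card (Quot r₂) := by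
    rw [Nat.card_congr (quotSum r₁ r₂), Nat.card_sum]
  have n0 : ∀ x y, Quot.mk R0 (Sum.inl x) ≠ Quot.mk R0 (Sum.inr y) := by
    intro x y h
    have := congrArg (quotSum r₁ r₂) h
    simp [quotSum] at this
  have c1 : Nat.card (Quot R1) + (if P then 1 else 0) = Nat.card (Quot R0) := by
    by_cases hP : P
    · rw [if_pos hP]
      refine (card_quot_merge R0 R1 (Sum.inl a₁) (Sum.inr a₂) (fun x y h => Or.inl h)
        (Or.inr ⟨hP, rfl⟩) ?_).2 (n0 _ _)
      rintro x y (h | ⟨-, h⟩)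
      · exact Or.inl h
      · right
        rw [Sym2.eq_iff] at h
        tauto
    · have : R1 = R0 := by ext x y; simp [hR1, hP]
      simp [this, hP]
  have n1 : Quot.mk R1 (Sum.inl b₁) = Quot.mk R1 (Sum.inr b₂) ↔
      (P ∧ Quot.mk r₁ a₁ = Quot.mk r₁ b₁ ∧ Quot.mk r₂ a₂ = Quot.mk r₂ b₂) := by
    constructor
    · intro h
      by_cases hP : P
      · refine ⟨hP, ?_, ?_⟩
        · by_contra hc
          let g : V₁ ⊕ V₂ → Prop := Sum.elim (fun x => Quot.mk r₁ x = Quot.mk r₁ b₁) (fun _ => False)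
          have hg : ∀ x y, R1 x y → g x = g y := by
            rintro x y ((h | h) | ⟨-, h⟩)
            · simp [g, Quot.sound h]
            · simp [g]
            · rw [Sym2.eq_iff] at h
              rcases h with ⟨rfl, rfl⟩ | ⟨rfl, rfl⟩ <;> simp [g, hc]
          have := congrArg (Quot.lift g hg) h
          simp [g] at this
        · by_contra hc
          let g : V₁ ⊕ V₂ → Prop := Sum.elim (fun _ => False) (fun x => Quot.mk r₂ x = Quot.mk r₂ b₂)
          have hg : ∀ x y, R1 x y → g x = g y := by
            rintro x y ((h | h) | ⟨-, h⟩)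
            · simp [g]
            · simp [g, Quot.sound h]
            · rw [Sym2.eq_iff] at h
              rcases h with ⟨rfl, rfl⟩ | ⟨rfl, rfl⟩ <;> simp [g, hc]
          have := congrArg (Quot.lift g hg) h
          simp [g] at this
      · exfalso
        have : R1 = R0 := by ext x y; simp [hR1, hP]
        rw [this] at h
        exact n0 _ _ h
    · rintro ⟨hP, h, h'⟩
      have s1 := congrArg (Quot.lift (fun x => Quot.mk R1 (Sum.inl x))
        (fun x y h => Quot.sound (Or.inl (Sum.LiftRel.inl h)))) h
      have s2 := congrArg (Quot.lift (fun x => Quot.mk R1 (Sum.inr x))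
        (fun x y h => Quot.sound (Or.inl (Sum.LiftRel.inr h)))) h'
      have s3 : Quot.mk R1 (Sum.inl a₁) = Quot.mk R1 (Sum.inr a₂) := Quot.sound (Or.inr ⟨hP, rfl⟩)
      exact (s1.symm.trans s3).trans s2
  have c2 : Nat.card (Quot R) + (if Q ∧ ¬ (P ∧ Quot.mk r₁ a₁ = Quot.mk r₁ b₁ ∧
      Quot.mk r₂ a₂ = Quot.mk r₂ b₂) then 1 else 0) = Nat.card (Quot R1) := by
    simp only [← n1]
    by_cases hQ : Q
    · have m := card_quot_merge R1 R (Sum.inl b₁) (Sum.inr b₂)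
        (fun x y h => (hR x y).2 (by rcases h with h | h <;> tauto))
        ((hR _ _).2 (Or.inr (Or.inr ⟨hQ, rfl⟩))) (by
          intro x y h
          rcases (hR x y).1 h with h | h | ⟨-, h⟩
          · exact Or.inl (Or.inl h)
          · exact Or.inl (Or.inr h)
          · right
            rw [Sym2.eq_iff] at h
            tauto)
      by_cases hc : Quot.mk R1 (Sum.inl b₁) = Quot.mk R1 (Sum.inr b₂)
      · simp [hc, m.1 hc]
      · simp [hc, hQ, m.2 hc]
    · have : R = R1 := by
        ext x y
        rw [hR]
        simp [hR1, hQ]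
      simp [this, hQ]
  omega

variable {V E : Type*} (G : Multigraph V E)

/-- Adjacency by edges avoiding `e₀` and avoiding `A`. -/
def avoidRel (e₀ : E) (A : Set V) (x y : V) : Prop :=
  ∃ e, e ∉ G.inc A ∧ e ≠ e₀ ∧ G.ends e = s(x, y)

theorem mem_inc_of_ends {e : E} {a b : V} (he : G.ends e = s(a, b)) (A : Set V) :
    e ∈ G.inc A ↔ a ∈ A ∨ b ∈ A := by
  simp only [inc, Set.mem_ofPred_eq, he, Sym2.mem_iff]
  constructor
  · rintro ⟨v, hv, rfl | rfl⟩ <;> tauto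
  · rintro (h | h)
    · exact ⟨a, h, Or.inl rfl⟩
    · exact ⟨b, h, Or.inr rfl⟩

open Classical in
theorem numComp_eq [Finite V] {e : E} {a b : V} (he : G.ends e = s(a, b)) (A : Set V) :
    G.numComponentsEdges (G.inc A)ᶜ +
      (if (a ∉ A ∧ b ∉ A) ∧ Quot.mk (G.avoidRel e A) a ≠ Quot.mk (G.avoidRel e A) b then 1 else 0)
      = Nat.card (Quot (G.avoidRel e A)) := by
  have hm := G.mem_inc_of_ends he A
  unfold numComponentsEdges
  by_cases h : e ∈ G.inc A
  · have h' : ¬ (a ∉ A ∧ b ∉ A) := by tauto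
    have : (fun u v => ∃ f ∈ (G.inc A)ᶜ, G.ends f = s(u, v)) = G.avoidRel e A := by
      ext x y
      simp only [avoidRel, Set.mem_compl_iff]
      constructor
      · rintro ⟨f, hf, hh⟩
        exact ⟨f, hf, by rintro rfl; exact hf h, hh⟩
      · rintro ⟨f, hf, -, hh⟩
        exact ⟨f, hf, hh⟩
    rw [this]
    simp [h']
  · have h' : a ∉ A ∧ b ∉ A := by tauto
    have m := card_quot_merge (G.avoidRel e A) (fun u v => ∃ f ∈ (G.inc A)ᶜ, G.ends f = s(u, v))
      a b (fun x y ⟨f, hf, _, hh⟩ => ⟨f, hf, hh⟩) ⟨e, h, he⟩ (by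
        rintro x y ⟨f, hf, hh⟩
        by_cases hfe : f = e
        · subst hfe
          rw [he, Sym2.eq_iff] at hh
          right; tauto
        · exact Or.inl ⟨f, hf, hfe, hh⟩)
    by_cases hc : Quot.mk (G.avoidRel e A) a = Quot.mk (G.avoidRel e A) b
    · rw [if_neg (fun h => h.2 hc), add_zero]
      exact m.1 hc
    · rw [if_pos ⟨h', hc⟩, m.2 hc]

open Classical in
theorem ncard_diff_add {α : Type*} [Finite α] (S : Set α) (e : α) :
    S.ncard = (S \ {e}).ncard + if e ∈ S then 1 else 0 := by
  by_cases h : e ∈ S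
  · rw [if_pos h, Set.ncard_sdiff_singleton_add_one h]
  · simp [h]

theorem ncard_sum {α β : Type*} [Finite α] [Finite β] (S : Set (α ⊕ β)) :
    S.ncard = (Sum.inl ⁻¹' S).ncard + (Sum.inr ⁻¹' S).ncard := by
  conv_lhs => rw [← Set.image_preimage_inl_union_image_preimage_inr S]
  rw [Set.ncard_union_eq, Set.ncard_image_of_injective _ Sum.inl_injective,
    Set.ncard_image_of_injective _ Sum.inr_injective]
  rw [Set.disjoint_left]
  rintro _ ⟨x, _, rfl⟩ ⟨y, _, h⟩
  cases h

theorem numComp_le [Finite V] (B : Set E) : G.numComponentsEdges B ≤ Nat.card V :=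
  Nat.card_le_card_of_surjective _ Quot.mk_surjective

theorem bondRank_le_iff [Finite V] (hG : G.Connected) (A : Set V) :
    G.bondRank (G.inc A) ≤ A.ncard ↔
      (G.inc A).ncard + 1 ≤ A.ncard + G.numComponentsEdges (G.inc A)ᶜ := by
  have h1 := G.numComp_le (G.inc A)ᶜ
  have h2 := G.numComp_le Set.univ
  unfold Connected at hG
  unfold bondRank cycleRank
  omega

theorem depMG_iff [Finite V] (A : Set V) :
    G.DepMG A ↔ ∃ C ⊆ A, C.Nonempty ∧ G.bondRank (G.inc C) ≤ C.ncard := by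
  constructor
  · rintro ⟨C, hC, h1, h2, -⟩
    exact ⟨C, hC, h1, h2⟩
  · rintro ⟨C, hC, h1, h2⟩
    obtain ⟨D, hD, hm⟩ := exists_minimal_le_of_wellFoundedLT
      (fun C : Set V => C.Nonempty ∧ G.bondRank (G.inc C) ≤ C.ncard) C ⟨h1, h2⟩
    refine ⟨D, hD.trans hC, hm.prop.1, hm.prop.2, fun D' hD' hne => ?_⟩
    by_contra hc
    exact hm.not_prop_of_lt hD' ⟨hne, not_lt.1 hc⟩

theorem avoid_empty [Finite V] (h : G.TwoEdgeConnected) (e : E) :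
    Nat.card (Quot (G.avoidRel e ∅)) = 1 ∧
      ∀ a b, Quot.mk (G.avoidRel e ∅) a = Quot.mk (G.avoidRel e ∅) b := by
  have h1 : Nat.card (Quot (G.avoidRel e ∅)) = 1 := by
    have h2 := h.2 e
    unfold numComponentsEdges at h2
    have : (fun u v => ∃ f ∈ ({e}ᶜ : Set E), G.ends f = s(u, v)) = G.avoidRel e ∅ := by
      ext x y
      simp [avoidRel, inc]
    rwa [this] at h2
  refine ⟨h1, fun a b => ?_⟩
  have := (Nat.card_eq_one_iff_unique.1 h1).1
  exact Subsingleton.elim _ _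

end Multigraph

section switch
open Multigraph
variable {V₁ E₁ V₂ E₂ : Type*}
    (G₁ : Multigraph V₁ E₁) (G₂ : Multigraph V₂ E₂)
    (e₁ : E₁) (e₂ : E₂) (a₁ b₁ : V₁) (a₂ b₂ : V₂)

theorem twoSwitch_ends_e1 : (G₁.twoSwitch G₂ e₁ e₂ a₁ b₁ a₂ b₂).ends (Sum.inl e₁) =
    s(Sum.inl a₁, Sum.inr a₂) := by simp [twoSwitch]

theorem twoSwitch_ends_e2 : (G₁.twoSwitch G₂ e₁ e₂ a₁ b₁ a₂ b₂).ends (Sum.inr e₂) =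
    s(Sum.inl b₁, Sum.inr b₂) := by simp [twoSwitch]

theorem twoSwitch_ends_inl (e : E₁) (h : e ≠ e₁) :
    (G₁.twoSwitch G₂ e₁ e₂ a₁ b₁ a₂ b₂).ends (Sum.inl e) = (G₁.ends e).map Sum.inl := by
  simp [twoSwitch, h]

theorem twoSwitch_ends_inr (e : E₂) (h : e ≠ e₂) :
    (G₁.twoSwitch G₂ e₁ e₂ a₁ b₁ a₂ b₂).ends (Sum.inr e) = (G₂.ends e).map Sum.inr := by
  simp [twoSwitch, h]

theorem twoSwitch_inc_inl (A : Set (V₁ ⊕ V₂)) (e : E₁) (h : e ≠ e₁) :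
    Sum.inl e ∈ (G₁.twoSwitch G₂ e₁ e₂ a₁ b₁ a₂ b₂).inc A ↔ e ∈ G₁.inc (Sum.inl ⁻¹' A) := by
  simp only [inc, Set.mem_ofPred_eq, twoSwitch_ends_inl _ _ _ _ _ _ _ _ e h, Sym2.mem_map]
  constructor
  · rintro ⟨v, hv, w, hw, rfl⟩
    exact ⟨w, hv, hw⟩
  · rintro ⟨w, hv, hw⟩
    exact ⟨_, hv, w, hw, rfl⟩

theorem twoSwitch_inc_inr (A : Set (V₁ ⊕ V₂)) (e : E₂) (h : e ≠ e₂) :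
    Sum.inr e ∈ (G₁.twoSwitch G₂ e₁ e₂ a₁ b₁ a₂ b₂).inc A ↔ e ∈ G₂.inc (Sum.inr ⁻¹' A) := by
  simp only [inc, Set.mem_ofPred_eq, twoSwitch_ends_inr _ _ _ _ _ _ _ _ e h, Sym2.mem_map]
  constructor
  · rintro ⟨v, hv, w, hw, rfl⟩
    exact ⟨w, hv, hw⟩
  · rintro ⟨w, hv, hw⟩
    exact ⟨_, hv, w, hw, rfl⟩

open Classical in
theorem twoSwitch_inc_ncard [Finite E₁] [Finite E₂] (A : Set (V₁ ⊕ V₂)) :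
    ((G₁.twoSwitch G₂ e₁ e₂ a₁ b₁ a₂ b₂).inc A).ncard =
      (G₁.inc (Sum.inl ⁻¹' A) \ {e₁}).ncard + (G₂.inc (Sum.inr ⁻¹' A) \ {e₂}).ncard
      + (if Sum.inl a₁ ∈ A ∨ Sum.inr a₂ ∈ A then 1 else 0)
      + (if Sum.inl b₁ ∈ A ∨ Sum.inr b₂ ∈ A then 1 else 0) := by
  rw [ncard_sum, ncard_diff_add (Sum.inl ⁻¹' _) e₁, ncard_diff_add (Sum.inr ⁻¹' _) e₂]
  have i1 : Sum.inl ⁻¹' ((G₁.twoSwitch G₂ e₁ e₂ a₁ b₁ a₂ b₂).inc A) \ {e₁} =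
      G₁.inc (Sum.inl ⁻¹' A) \ {e₁} := by
    ext e
    simp only [Set.mem_sdiff, Set.mem_preimage, Set.mem_singleton_iff]
    exact and_congr_left fun h => twoSwitch_inc_inl _ _ _ _ _ _ _ _ A e h
  have i2 : Sum.inr ⁻¹' ((G₁.twoSwitch G₂ e₁ e₂ a₁ b₁ a₂ b₂).inc A) \ {e₂} =
      G₂.inc (Sum.inr ⁻¹' A) \ {e₂} := by
    ext e
    simp only [Set.mem_sdiff, Set.mem_preimage, Set.mem_singleton_iff]
    exact and_congr_left fun h => twoSwitch_inc_inr _ _ _ _ _ _ _ _ A e h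
  rw [i1, i2]
  simp only [Set.mem_preimage, mem_inc_of_ends _ (twoSwitch_ends_e1 G₁ G₂ e₁ e₂ a₁ b₁ a₂ b₂),
    mem_inc_of_ends _ (twoSwitch_ends_e2 G₁ G₂ e₁ e₂ a₁ b₁ a₂ b₂)]
  omega

open Classical in
theorem twoSwitch_numComp [Finite V₁] [Finite V₂] (A : Set (V₁ ⊕ V₂))
    (r₁ : V₁ → V₁ → Prop) (r₂ : V₂ → V₂ → Prop)
    (hr₁ : r₁ = G₁.avoidRel e₁ (Sum.inl ⁻¹' A)) (hr₂ : r₂ = G₂.avoidRel e₂ (Sum.inr ⁻¹' A)) :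
    (G₁.twoSwitch G₂ e₁ e₂ a₁ b₁ a₂ b₂).numComponentsEdges
        ((G₁.twoSwitch G₂ e₁ e₂ a₁ b₁ a₂ b₂).inc A)ᶜ
      + (if Sum.inl a₁ ∉ A ∧ Sum.inr a₂ ∉ A then 1 else 0) +
      (if (Sum.inl b₁ ∉ A ∧ Sum.inr b₂ ∉ A) ∧ ¬ ((Sum.inl a₁ ∉ A ∧ Sum.inr a₂ ∉ A) ∧
        Quot.mk r₁ a₁ = Quot.mk r₁ b₁ ∧ Quot.mk r₂ a₂ = Quot.mk r₂ b₂) then 1 else 0)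
      = Nat.card (Quot r₁) + Nat.card (Quot r₂) := by
  have main := card_quot_cross r₁ r₂ a₁ b₁ a₂ b₂ (Sum.inl a₁ ∉ A ∧ Sum.inr a₂ ∉ A)
    (Sum.inl b₁ ∉ A ∧ Sum.inr b₂ ∉ A)
    (fun u v => ∃ e ∈ ((G₁.twoSwitch G₂ e₁ e₂ a₁ b₁ a₂ b₂).inc A)ᶜ,
      (G₁.twoSwitch G₂ e₁ e₂ a₁ b₁ a₂ b₂).ends e = s(u, v)) ?_
  · unfold numComponentsEdges
    convert main
  have m1 := mem_inc_of_ends _ (twoSwitch_ends_e1 G₁ G₂ e₁ e₂ a₁ b₁ a₂ b₂) A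
  have m2 := mem_inc_of_ends _ (twoSwitch_ends_e2 G₁ G₂ e₁ e₂ a₁ b₁ a₂ b₂) A
  intro x y
  constructor
  · rintro ⟨e | e, he, hxy⟩
    · by_cases h : e = e₁
      · subst h
        right; left
        rw [twoSwitch_ends_e1] at hxy
        rw [Set.mem_compl_iff, m1] at he
        exact ⟨by tauto, hxy⟩
      · left
        rw [Set.mem_compl_iff, twoSwitch_inc_inl _ _ _ _ _ _ _ _ _ _ h] at he
        rw [twoSwitch_ends_inl _ _ _ _ _ _ _ _ _ h] at hxy
        obtain ⟨p, q⟩ : ∃ p q, G₁.ends e = s(p, q) := by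
          induction G₁.ends e with | _ p q => exact ⟨p, q, rfl⟩
        obtain ⟨q, hpq⟩ := q
        rw [hpq, Sym2.map_mk, Sym2.eq_iff] at hxy
        rcases hxy with ⟨rfl, rfl⟩ | ⟨rfl, rfl⟩
        · exact Sum.LiftRel.inl (hr₁ ▸ ⟨e, he, h, hpq⟩)
        · exact Sum.LiftRel.inl (hr₁ ▸ ⟨e, he, h, hpq.trans Sym2.eq_swap⟩)
    · by_cases h : e = e₂
      · subst h
        right; right
        rw [twoSwitch_ends_e2] at hxy
        rw [Set.mem_compl_iff, m2] at he
        exact ⟨by tauto, hxy⟩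
      · left
        rw [Set.mem_compl_iff, twoSwitch_inc_inr _ _ _ _ _ _ _ _ _ _ h] at he
        rw [twoSwitch_ends_inr _ _ _ _ _ _ _ _ _ h] at hxy
        obtain ⟨p, q⟩ : ∃ p q, G₂.ends e = s(p, q) := by
          induction G₂.ends e with | _ p q => exact ⟨p, q, rfl⟩
        obtain ⟨q, hpq⟩ := q
        rw [hpq, Sym2.map_mk, Sym2.eq_iff] at hxy
        rcases hxy with ⟨rfl, rfl⟩ | ⟨rfl, rfl⟩
        · exact Sum.LiftRel.inr (hr₂ ▸ ⟨e, he, h, hpq⟩)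
        · exact Sum.LiftRel.inr (hr₂ ▸ ⟨e, he, h, hpq.trans Sym2.eq_swap⟩)
  · rintro (h | ⟨h, hxy⟩ | ⟨h, hxy⟩)
    · rcases h with h | h
      · rw [hr₁] at h
        obtain ⟨e, he, hne, hh⟩ := h
        refine ⟨Sum.inl e, ?_, ?_⟩
        · rwa [Set.mem_compl_iff, twoSwitch_inc_inl _ _ _ _ _ _ _ _ _ _ hne]
        · rw [twoSwitch_ends_inl _ _ _ _ _ _ _ _ _ hne, hh, Sym2.map_mk]
      · rw [hr₂] at h
        obtain ⟨e, he, hne, hh⟩ := h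
        refine ⟨Sum.inr e, ?_, ?_⟩
        · rwa [Set.mem_compl_iff, twoSwitch_inc_inr _ _ _ _ _ _ _ _ _ _ hne]
        · rw [twoSwitch_ends_inr _ _ _ _ _ _ _ _ _ hne, hh, Sym2.map_mk]
    · exact ⟨Sum.inl e₁, by rw [Set.mem_compl_iff, m1]; tauto, by rw [twoSwitch_ends_e1, hxy]⟩
    · exact ⟨Sum.inr e₂, by rw [Set.mem_compl_iff, m2]; tauto, by rw [twoSwitch_ends_e2, hxy]⟩

/-- The basic comparison of the defining inequalities. -/
theorem twoSwitch_main [Finite V₁] [Finite V₂] [Finite E₁] [Finite E₂]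
    (h₁2 : G₁.TwoEdgeConnected) (h₂2 : G₂.TwoEdgeConnected)
    (he₁ : G₁.ends e₁ = s(a₁, b₁)) (he₂ : G₂.ends e₂ = s(a₂, b₂)) (A : Set (V₁ ⊕ V₂)) :
    let G := G₁.twoSwitch G₂ e₁ e₂ a₁ b₁ a₂ b₂
    let A₁ : Set V₁ := Sum.inl ⁻¹' A
    let A₂ : Set V₂ := Sum.inr ⁻¹' A
    let f : ℤ := A.ncard + G.numComponentsEdges (G.inc A)ᶜ - (G.inc A).ncard - 1
    let f₁ : ℤ := A₁.ncard + G₁.numComponentsEdges (G₁.inc A₁)ᶜ - (G₁.inc A₁).ncard - 1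
    let f₂ : ℤ := A₂.ncard + G₂.numComponentsEdges (G₂.inc A₂)ᶜ - (G₂.inc A₂).ncard - 1
    f ≤ f₁ + f₂ + 1 ∧ (A₂ = ∅ → f = f₁) ∧ (A₁ = ∅ → f = f₂) := by
  classical
  intro G A₁ A₂ f f₁ f₂
  have ma1 : Sum.inl a₁ ∈ A ↔ a₁ ∈ A₁ := Iff.rfl
  have mb1 : Sum.inl b₁ ∈ A ↔ b₁ ∈ A₁ := Iff.rfl
  have ma2 : Sum.inr a₂ ∈ A ↔ a₂ ∈ A₂ := Iff.rfl
  have mb2 : Sum.inr b₂ ∈ A ↔ b₂ ∈ A₂ := Iff.rfl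
  have hA : A.ncard = A₁.ncard + A₂.ncard := ncard_sum A
  have d := twoSwitch_inc_ncard G₁ G₂ e₁ e₂ a₁ b₁ a₂ b₂ A
  have d1 := ncard_diff_add (G₁.inc A₁) e₁
  have d2 := ncard_diff_add (G₂.inc A₂) e₂
  rw [mem_inc_of_ends _ he₁] at d1
  rw [mem_inc_of_ends _ he₂] at d2
  have c := twoSwitch_numComp G₁ G₂ e₁ e₂ a₁ b₁ a₂ b₂ A _ _ rfl rfl
  have c1 := G₁.numComp_eq he₁ A₁
  have c2 := G₂.numComp_eq he₂ A₂
  have z1 : A₁ = ∅ → A₁.ncard = 0 ∧ (G₁.inc A₁ \ {e₁}).ncard = 0 ∧ a₁ ∉ A₁ ∧ b₁ ∉ A₁ ∧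
      Nat.card (Quot (G₁.avoidRel e₁ A₁)) = 1 ∧
      Quot.mk (G₁.avoidRel e₁ A₁) a₁ = Quot.mk (G₁.avoidRel e₁ A₁) b₁ := by
    intro h
    rw [h]
    obtain ⟨p, q⟩ := G₁.avoid_empty h₁2 e₁
    exact ⟨by simp, by simp [inc], by simp, by simp, p, q _ _⟩
  have z2 : A₂ = ∅ → A₂.ncard = 0 ∧ (G₂.inc A₂ \ {e₂}).ncard = 0 ∧ a₂ ∉ A₂ ∧ b₂ ∉ A₂ ∧
      Nat.card (Quot (G₂.avoidRel e₂ A₂)) = 1 ∧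
      Quot.mk (G₂.avoidRel e₂ A₂) a₂ = Quot.mk (G₂.avoidRel e₂ A₂) b₂ := by
    intro h
    rw [h]
    obtain ⟨p, q⟩ := G₂.avoid_empty h₂2 e₂
    exact ⟨by simp, by simp [inc], by simp, by simp, p, q _ _⟩
  simp only [ma1, mb1, ma2, mb2] at d c
  change _ + _ + _ = Nat.card (Quot (G₁.avoidRel e₁ A₁)) + Nat.card (Quot (G₂.avoidRel e₂ A₂)) at c
  change (G.inc A).ncard = (G₁.inc A₁ \ {e₁}).ncard + (G₂.inc A₂ \ {e₂}).ncard + _ + _ at d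
  change G.numComponentsEdges (G.inc A)ᶜ + _ + (if _ ∧ ¬ (_ ∧
    Quot.mk (G₁.avoidRel e₁ A₁) a₁ = Quot.mk (G₁.avoidRel e₁ A₁) b₁ ∧
    Quot.mk (G₂.avoidRel e₂ A₂) a₂ = Quot.mk (G₂.avoidRel e₂ A₂) b₂) then 1 else 0) = _ at c
  simp only [f, f₁, f₂]
  have fin : ∀ (Q1 Q2 p1 q1 p2 q2 : Prop) (nA nA1 nA2 i i1 i2 d1 d2 k k1 k2 m1 m2 : ℕ) (E1 E2 : Prop),
      nA = nA1 + nA2 →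
      i = d1 + d2 + (if p1 ∨ p2 then 1 else 0) + (if q1 ∨ q2 then 1 else 0) →
      i1 = d1 + (if p1 ∨ q1 then 1 else 0) → i2 = d2 + (if p2 ∨ q2 then 1 else 0) →
      k + (if ¬ p1 ∧ ¬ p2 then 1 else 0) +
        (if (¬ q1 ∧ ¬ q2) ∧ ¬ ((¬ p1 ∧ ¬ p2) ∧ Q1 ∧ Q2) then 1 else 0) = m1 + m2 →
      k1 + (if (¬ p1 ∧ ¬ q1) ∧ ¬ Q1 then 1 else 0) = m1 →
      k2 + (if (¬ p2 ∧ ¬ q2) ∧ ¬ Q2 then 1 else 0) = m2 →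
      (E1 → nA1 = 0 ∧ d1 = 0 ∧ ¬ p1 ∧ ¬ q1 ∧ m1 = 1 ∧ Q1) →
      (E2 → nA2 = 0 ∧ d2 = 0 ∧ ¬ p2 ∧ ¬ q2 ∧ m2 = 1 ∧ Q2) →
      ((nA + k - i - 1 : ℤ) ≤ (nA1 + k1 - i1 - 1) + (nA2 + k2 - i2 - 1) + 1 ∧
        (E2 → (nA + k - i - 1 : ℤ) = nA1 + k1 - i1 - 1) ∧
        (E1 → (nA + k - i - 1 : ℤ) = nA2 + k2 - i2 - 1)) := by
    intro Q1 Q2 p1 q1 p2 q2 nA nA1 nA2 i i1 i2 d1 d2 k k1 k2 m1 m2 E1 E2 g0 g1 g2 g3 g4 g5 g6 g7 g8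
    by_cases x1 : Q1 <;> by_cases x2 : Q2 <;> by_cases x3 : p1 <;> by_cases x4 : q1 <;>
      by_cases x5 : p2 <;> by_cases x6 : q2 <;>
      simp only [x1, x2, x3, x4, x5, x6, not_true_eq_false, not_false_eq_true, and_true, true_and,
        and_false, false_and, or_true, true_or, or_false, if_true, if_false,
        imp_false] at g1 g2 g3 g4 g5 g6 g7 g8 <;>
      refine ⟨by omega, fun hE => ?_, fun hE => ?_⟩ <;>
      first
        | exact absurd hE g7
        | exact absurd hE g8
        | (have := g7 hE; omega)
        | (have := g8 hE; omega)
  exact fin _ _ _ _ _ _ _ _ _ _ _ _ _ _ _ _ _ _ _ _ _ hA d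
    (by convert d1) (by convert d2)
    (by convert c) (by convert c1) (by convert c2) z1 z2

end switch

/-- Let `G₁`, `G₂` be trivalent 2-edge-connected finite graphs
with edges `e₁ = (a₁,b₁) ∈ E₁` and `e₂ = (a₂,b₂) ∈ E₂`, and let `G` be obtained
from `G₁ ⊔ G₂` by replacing these edges with `(a₁,a₂)` and `(b₁,b₂)`. Then
`M_G = M_{G₁} ⊕ M_{G₂}`: a set is independent in `M_G` iff its parts in `V₁`
and `V₂` are independent in `M_{G₁}` and `M_{G₂}` respectively. -/
theorem graphCurveMatroid_twoSwitch {V₁ E₁ V₂ E₂ : Type*}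
    [Fintype V₁] [Fintype E₁] [Fintype V₂] [Fintype E₂]
    (G₁ : Multigraph V₁ E₁) (G₂ : Multigraph V₂ E₂)
    (h₁3 : G₁.Trivalent) (h₁2 : G₁.TwoEdgeConnected)
    (h₂3 : G₂.Trivalent) (h₂2 : G₂.TwoEdgeConnected)
    (e₁ : E₁) (e₂ : E₂) (a₁ b₁ : V₁) (a₂ b₂ : V₂)
    (he₁ : G₁.ends e₁ = s(a₁, b₁)) (he₂ : G₂.ends e₂ = s(a₂, b₂))
    (A : Set (V₁ ⊕ V₂)) :
    (G₁.twoSwitch G₂ e₁ e₂ a₁ b₁ a₂ b₂).IndepMG A ↔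
      G₁.IndepMG (Sum.inl ⁻¹' A) ∧ G₂.IndepMG (Sum.inr ⁻¹' A) := by
  have key := twoSwitch_main G₁ G₂ e₁ e₂ a₁ b₁ a₂ b₂ h₁2 h₂2 he₁ he₂
  have hconn : (G₁.twoSwitch G₂ e₁ e₂ a₁ b₁ a₂ b₂).Connected := by
    have c := twoSwitch_numComp G₁ G₂ e₁ e₂ a₁ b₁ a₂ b₂ ∅ _ _ rfl rfl
    simp only [Set.preimage_empty] at c
    obtain ⟨p1, q1⟩ := G₁.avoid_empty h₁2 e₁
    obtain ⟨p2, q2⟩ := G₂.avoid_empty h₂2 e₂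
    rw [p1, p2] at c
    simp [q1 a₁ b₁, q2 a₂ b₂, Multigraph.inc] at c
    exact c
  unfold Multigraph.IndepMG
  rw [← not_or, not_iff_not]
  simp only [Multigraph.depMG_iff, Multigraph.bondRank_le_iff _ hconn,
    Multigraph.bondRank_le_iff _ h₁2.1, Multigraph.bondRank_le_iff _ h₂2.1]
  constructor
  · rintro ⟨C, hC, hne, h⟩
    obtain ⟨k0, k1, k2⟩ := key C
    rcases (Sum.inl ⁻¹' C : Set V₁).eq_empty_or_nonempty with n1 | n1
    · right
      have k2 := k2 n1
      refine ⟨Sum.inr ⁻¹' C, Set.preimage_mono hC, ?_, by omega⟩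
      obtain ⟨x | x, hx⟩ := hne
      · exact absurd (show x ∈ Sum.inl ⁻¹' C from hx) (by rw [n1]; simp)
      · exact ⟨x, hx⟩
    · rcases (Sum.inr ⁻¹' C : Set V₂).eq_empty_or_nonempty with n2 | n2
      · have k1 := k1 n2
        exact Or.inl ⟨Sum.inl ⁻¹' C, Set.preimage_mono hC, n1, by omega⟩
      · by_cases hh : (G₁.inc (Sum.inl ⁻¹' C)).ncard + 1 ≤ (Sum.inl ⁻¹' C : Set V₁).ncard +
            G₁.numComponentsEdges (G₁.inc (Sum.inl ⁻¹' C))ᶜ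
        · exact Or.inl ⟨Sum.inl ⁻¹' C, Set.preimage_mono hC, n1, hh⟩
        · exact Or.inr ⟨Sum.inr ⁻¹' C, Set.preimage_mono hC, n2, by omega⟩
  · rintro (⟨C, hC, hne, h⟩ | ⟨C, hC, hne, h⟩)
    · obtain ⟨-, k1, -⟩ := key (Sum.inl '' C)
      have k1 := k1 (by ext x; simp)
      rw [Set.preimage_image_eq C Sum.inl_injective] at k1
      exact ⟨Sum.inl '' C, Set.image_subset_iff.2 hC, hne.image _, by omega⟩
    · obtain ⟨-, -, k2⟩ := key (Sum.inr '' C)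
      have k2 := k2 (by ext x; simp)
      rw [Set.preimage_image_eq C Sum.inr_injective] at k2
      exact ⟨Sum.inr '' C, Set.image_subset_iff.2 hC, hne.image _, by omega⟩
end
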